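/- arXiv:math/0403145 — 3 statements merged into one kernel-verified Lean document; each statement's English description precedes it below -/
import Mathlib

section
/- Let G be a group, let L : G → ℤ be a group homomorphism, and let z be an infinite-order central element of G with L(z) ∉ {0, −1, −2}. Then the map φ : G → G defined by φ(g) = g·z^{L(g)} is a group homomorphism which is injective but not surjective (indeed, z is not in the image of φ). In particular, G is not co-Hopfian. -/
/-- An additive integer-valued function on a group multiplies by `n` on `n`-th powers. -/
theorem map_zpow_of_map_mul_eq_add {G : Type*} [Group G] (L : G → ℤ)
    (hL : ∀ a b : G, L (a * b) = L a + L b) (g : G) (n : ℤ) : L (g ^ n) = n * L g := by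
  let f : G →* Multiplicative ℤ := MonoidHom.mk' (fun a => Multiplicative.ofAdd (L a)) fun a b => by
    rw [hL, ofAdd_add]
  simpa [f] using congrArg Multiplicative.toAdd (map_zpow f g n)


/-- If `G` is a group, `L : G → ℤ` a group homomorphism, and `z` an
infinite-order central element with `L z ∉ {0, -1, -2}`, then `g ↦ g * z ^ L g` is an
injective, non-surjective group endomorphism of `G` (indeed `z` is not in its image);
in particular `G` is not co-Hopfian. -/
theorem braid_coHopf_obstruction {G : Type*} [Group G] (L : G → ℤ)
    (hL : ∀ a b : G, L (a * b) = L a + L b)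
    (z : G) (hz : z ∈ Subgroup.center G) (hzord : ¬ IsOfFinOrder z)
    (hLz : L z ∉ ({0, -1, -2} : Set ℤ)) :
    ∃ φ : G →* G, (∀ g : G, φ g = g * z ^ L g) ∧
      Function.Injective φ ∧ ¬ Function.Surjective φ ∧ z ∉ Set.range φ ∧
      ¬ (∀ ψ : G →* G, Function.Injective ψ → Function.Surjective ψ) := by
  have hLφ (g : G) : L (g * z ^ L g) = L g * (1 + L z) := by
    rw [hL, map_zpow_of_map_mul_eq_add L hL]
    ring
  simp only [Set.mem_insert_iff, Set.mem_singleton_iff, not_or] at hLz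
  obtain ⟨h0, h1, h2⟩ := hLz
  let φ : G →* G := MonoidHom.mk' (fun g => g * z ^ L g) fun a b => by
    have hcomm : b * z ^ L a = z ^ L a * b :=
      Subgroup.mem_center_iff.mp (Subgroup.zpow_mem _ hz (L a)) b
    rw [hL, zpow_add, mul_assoc, mul_assoc, ← mul_assoc b, hcomm, mul_assoc]
  have hφ (g : G) : φ g = g * z ^ L g := rfl
  have hinj : Function.Injective φ := by
    refine (injective_iff_map_eq_one φ).mpr fun g hg => ?_
    have hL1 : L 1 = 0 := by simpa using hL 1 1
    have hmul : L g * (1 + L z) = 0 := by rw [← hLφ, ← hφ, hg, hL1]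
    have hLg : L g = 0 := (mul_eq_zero.mp hmul).resolve_right (by omega)
    simpa [hφ, hLg] using hg
  have hrange : z ∉ Set.range φ := by
    rintro ⟨g, hg⟩
    have hmul : L z = L g * (1 + L z) := by rw [← hLφ, ← hφ, hg]
    have hunit : IsUnit (1 + L z) := .of_mul_eq_one (1 - L g) (by linarith)
    rcases Int.isUnit_iff.mp hunit with h | h <;> omega
  have hsurj : ¬ Function.Surjective φ := fun h => hrange (h z)
  exact ⟨φ, hφ, hinj, hsurj, hrange, fun h => hsurj (h φ hinj)⟩
end

section
/- Let n ≥ 3 and let t be a nonzero integer. The assignment σ_i ↦ σ_i·z^t extends to a well-defined group endomorphism φ of the braid group B_n, which satisfies φ(g) = g·z^{t·ℓ(g)} for all g ∈ B_n; moreover φ is injective but not surjective. In particular, B_n is not co-Hopfian. -/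
/-- Relators for the braid group with generators `σ_0, …, σ_{m-1}`:
the braid relations `σ_i σ_j σ_i = σ_j σ_i σ_j` for `j = i+1`, and the
commutation relations `σ_i σ_j = σ_j σ_i` for `j ≥ i+2`. -/
def braidRels (m : ℕ) : Set (FreeGroup (Fin m)) :=
  { r | ∃ i j : Fin m,
      ((i : ℕ) + 1 = (j : ℕ) ∧
        r = FreeGroup.of i * FreeGroup.of j * FreeGroup.of i *
            (FreeGroup.of j * FreeGroup.of i * FreeGroup.of j)⁻¹) ∨
      ((i : ℕ) + 2 ≤ (j : ℕ) ∧
        r = FreeGroup.of i * FreeGroup.of j * (FreeGroup.of j * FreeGroup.of i)⁻¹) }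

/-- The braid group on `n` strands: the presented group with generators
`σ_1, …, σ_{n-1}` (indexed by `Fin (n-1)`) and the braid relators. -/
abbrev BraidGroup (n : ℕ) : Type := PresentedGroup (braidRels (n - 1))

/-- The standard generator `σ_{i+1}` of the braid group (0-indexed). -/
def braidσ (n : ℕ) (i : Fin (n - 1)) : BraidGroup n := PresentedGroup.of i

/-- The element `δ = σ_1 σ_2 ⋯ σ_{n-1}` of the braid group. -/
def braidδ (n : ℕ) : BraidGroup n := (List.ofFn (braidσ n)).prod

/-- The full twist `z = (σ_1 σ_2 ⋯ σ_{n-1})^n`. -/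
def fullTwist (n : ℕ) : BraidGroup n := braidδ n ^ n

section BraidRelations

variable {G : Type*} [Group G] {m : ℕ} {s : ℕ → G}

/-- The product `s 0 * s 1 * ⋯ * s (k - 1)`. -/
def initialProd (s : ℕ → G) : ℕ → G
  | 0 => 1
  | k + 1 => initialProd s k * s k

theorem initialProd_eq_prod_ofFn (s : ℕ → G) (k : ℕ) :
    initialProd s k = (List.ofFn fun i : Fin k => s i).prod := by
  induction k with
  | zero => simp [initialProd]
  | succ k ih => rw [initialProd, ih, List.ofFn_succ', List.concat_eq_append]; simp

theorem initialProd_mul_far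
    (hcomm : ∀ i j, i + 2 ≤ j → j < m → s i * s j = s j * s i)
    {j : ℕ} (hj : j < m) (k : ℕ) (hk : k + 1 ≤ j) :
    initialProd s k * s j = s j * initialProd s k := by
  induction k with
  | zero => simp [initialProd]
  | succ k ih =>
    rw [initialProd, mul_assoc, hcomm k j (by lia) hj, ← mul_assoc, ih (by lia), mul_assoc]

theorem initialProd_mul_shift
    (hcomm : ∀ i j, i + 2 ≤ j → j < m → s i * s j = s j * s i)
    (hbraid : ∀ i, i + 1 < m → s i * s (i + 1) * s i = s (i + 1) * s i * s (i + 1))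
    {i : ℕ} (k : ℕ) (hik : i + 1 < k) (hk : k ≤ m) :
    initialProd s k * s i = s (i + 1) * initialProd s k := by
  induction k, hik using Nat.le_induction with
  | base =>
    have hfar := initialProd_mul_far hcomm (j := i + 1) (by lia) i le_rfl
    calc initialProd s (i + 2) * s i
        = initialProd s i * (s i * s (i + 1) * s i) := by simp only [initialProd, mul_assoc]
      _ = initialProd s i * s (i + 1) * (s i * s (i + 1)) := by
        rw [hbraid i (by lia)]; simp only [mul_assoc]
      _ = s (i + 1) * initialProd s (i + 2) := by
        rw [hfar]; simp only [initialProd, mul_assoc]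
  | succ k hik ih =>
    rw [initialProd, mul_assoc, ← hcomm i k (by lia) (by lia), ← mul_assoc, ih (by lia), mul_assoc]

theorem initialProd_pow_mul_zero
    (hcomm : ∀ i j, i + 2 ≤ j → j < m → s i * s j = s j * s i)
    (hbraid : ∀ i, i + 1 < m → s i * s (i + 1) * s i = s (i + 1) * s i * s (i + 1))
    (j : ℕ) (hj : j < m) :
    initialProd s m ^ j * s 0 = s j * initialProd s m ^ j := by
  induction j with
  | zero => simp
  | succ j ih =>
    rw [pow_succ', mul_assoc, ih (by lia), ← mul_assoc,
      initialProd_mul_shift hcomm hbraid m hj le_rfl, mul_assoc]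

theorem zero_mul_initialProd_mul_zero_pow
    (hcomm : ∀ i j, i + 2 ≤ j → j < m → s i * s j = s j * s i)
    (hbraid : ∀ i, i + 1 < m → s i * s (i + 1) * s i = s (i + 1) * s i * s (i + 1))
    (k : ℕ) (hk : k < m) :
    s 0 * (initialProd s m * s 0) ^ k = initialProd s (k + 1) * initialProd s m ^ k := by
  induction k with
  | zero => simp [initialProd]
  | succ k ih =>
    rw [pow_succ, ← mul_assoc, ih (by lia), mul_assoc, ← mul_assoc (_ ^ k), ← pow_succ,
      initialProd_pow_mul_zero hcomm hbraid (k + 1) hk, ← mul_assoc, ← initialProd]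

theorem initialProd_pow_commute
    (hcomm : ∀ i j, i + 2 ≤ j → j < m → s i * s j = s j * s i)
    (hbraid : ∀ i, i + 1 < m → s i * s (i + 1) * s i = s (i + 1) * s i * s (i + 1))
    (j : ℕ) (hj : j < m) :
    Commute (initialProd s m ^ (m + 1)) (s j) := by
  obtain ⟨k, rfl⟩ : ∃ k, m = k + 1 := ⟨m - 1, by lia⟩
  set δ := initialProd s (k + 1)
  have hpow : (δ * s 0) ^ (k + 1) = δ ^ (k + 1 + 1) := by
    rw [pow_succ', mul_assoc, zero_mul_initialProd_mul_zero_pow hcomm hbraid k (by lia),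
      ← pow_succ', ← pow_succ']
  have hcδ : Commute (δ ^ (k + 1 + 1)) δ := Commute.pow_self δ _
  have hcε : Commute (δ ^ (k + 1 + 1)) (δ * s 0) := hpow ▸ Commute.pow_self (δ * s 0) (k + 1)
  have hc0 : Commute (δ ^ (k + 1 + 1)) (s 0) := by
    simpa using hcδ.inv_right.mul_right hcε
  have hsj : s j = δ ^ j * s 0 * (δ ^ j)⁻¹ :=
    eq_mul_inv_of_mul_eq (initialProd_pow_mul_zero hcomm hbraid j hj).symm
  rw [hsj]
  exact ((hcδ.pow_right j).mul_right hc0).mul_right (hcδ.pow_right j).inv_right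

end BraidRelations

/-- The generators of the braid group indexed by `ℕ`, extended by `1`. -/
def braidσNat (n i : ℕ) : BraidGroup n := if h : i < n - 1 then braidσ n ⟨i, h⟩ else 1

theorem braidδ_eq_initialProd (n : ℕ) : braidδ n = initialProd (braidσNat n) (n - 1) := by
  rw [initialProd_eq_prod_ofFn, braidδ]
  congr 2
  funext i
  simp [braidσNat]

theorem braidσNat_comm (n i j : ℕ) (hij : i + 2 ≤ j) (hj : j < n - 1) :
    braidσNat n i * braidσNat n j = braidσNat n j * braidσNat n i := by
  have hi : i < n - 1 := by lia
  simp only [braidσNat, hi, hj, dif_pos]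
  apply mul_inv_eq_one.mp
  exact PresentedGroup.one_of_mem (rels := braidRels (n - 1))
    ⟨⟨i, hi⟩, ⟨j, hj⟩, Or.inr ⟨hij, rfl⟩⟩

theorem braidσNat_braid (n i : ℕ) (hi : i + 1 < n - 1) :
    braidσNat n i * braidσNat n (i + 1) * braidσNat n i =
      braidσNat n (i + 1) * braidσNat n i * braidσNat n (i + 1) := by
  have hi' : i < n - 1 := by lia
  simp only [braidσNat, hi, hi', dif_pos]
  apply mul_inv_eq_one.mp
  exact PresentedGroup.one_of_mem (rels := braidRels (n - 1))
    ⟨⟨i, hi'⟩, ⟨i + 1, hi⟩, Or.inl ⟨rfl, rfl⟩⟩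

theorem fullTwist_mem_center {n : ℕ} (hn : 1 ≤ n) :
    fullTwist n ∈ Subgroup.center (BraidGroup n) := by
  rw [Subgroup.mem_center_iff]
  intro g
  have hg : g ∈ Subgroup.centralizer {fullTwist n} := by
    have hle : Subgroup.closure (Set.range (PresentedGroup.of (rels := braidRels (n - 1)))) ≤
        Subgroup.centralizer {fullTwist n} := by
      rw [Subgroup.closure_le]
      rintro _ ⟨i, rfl⟩
      rw [SetLike.mem_coe, Subgroup.mem_centralizer_singleton_iff]
      have h := initialProd_pow_commute (braidσNat_comm n) (braidσNat_braid n) i i.isLt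
      rw [← braidδ_eq_initialProd, Nat.sub_add_cancel hn] at h
      simpa [braidσNat, braidσ, fullTwist] using h.eq.symm
    rw [PresentedGroup.closure_range_of] at hle
    exact hle (Subgroup.mem_top g)
  exact Subgroup.mem_centralizer_singleton_iff.mp hg

theorem map_fullTwist_eq {n : ℕ} (f : BraidGroup n →* Multiplicative ℤ)
    (hf : ∀ i, f (braidσ n i) = Multiplicative.ofAdd 1) :
    (f (fullTwist n)).toAdd = n * ((n - 1 : ℕ) : ℤ) := by
  have hδ : f (braidδ n) = Multiplicative.ofAdd 1 ^ (n - 1) := by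
    rw [braidδ, map_list_prod, List.map_ofFn]
    have : f ∘ braidσ n = fun _ => Multiplicative.ofAdd 1 := funext hf
    simp [this]
  simp [fullTwist, hδ]

/-- For `n ≥ 3` and `t ≠ 0`, the assignment `σ_i ↦ σ_i * z^t` extends to a
well-defined endomorphism `φ` of `B_n` satisfying `φ g = g * z^(t * ℓ g)`, which is
injective but not surjective; in particular `B_n` is not co-Hopfian. -/
theorem braidGroup_not_coHopfian (n : ℕ) (hn : 3 ≤ n) (t : ℤ) (ht : t ≠ 0)
    (ℓ : BraidGroup n → ℤ) (hℓ : ∀ a b, ℓ (a * b) = ℓ a + ℓ b)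
    (hℓσ : ∀ i : Fin (n - 1), ℓ (braidσ n i) = 1) :
    ∃ φ : BraidGroup n →* BraidGroup n,
      (∀ i : Fin (n - 1), φ (braidσ n i) = braidσ n i * fullTwist n ^ t) ∧
      (∀ g : BraidGroup n, φ g = g * fullTwist n ^ (t * ℓ g)) ∧
      Function.Injective φ ∧ ¬ Function.Surjective φ ∧
      ¬ (∀ ψ : BraidGroup n →* BraidGroup n,
          Function.Injective ψ → Function.Surjective ψ) := by
  have hz : fullTwist n ∈ Subgroup.center (BraidGroup n) := fullTwist_mem_center (by lia)
  let L : BraidGroup n →* Multiplicative ℤ :=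
    MonoidHom.mk' (fun g => Multiplicative.ofAdd (ℓ g)) fun a b => by simp [hℓ]
  have hlen : ℓ (fullTwist n) = n * ((n - 1 : ℕ) : ℤ) :=
    map_fullTwist_eq L fun i => congrArg Multiplicative.ofAdd (hℓσ i)
  have hℓpow (g : BraidGroup n) (k : ℤ) : ℓ (g ^ k) = k * ℓ g := by
    have h := congrArg Multiplicative.toAdd (map_zpow L g k)
    simpa [L] using h
  let φ : BraidGroup n →* BraidGroup n :=
    MonoidHom.mk' (fun g => g * fullTwist n ^ (t * ℓ g)) fun a b => by
      have hc := Subgroup.mem_center_iff.mp (Subgroup.zpow_mem _ hz (t * ℓ a)) b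
      simp only [hℓ, mul_add, zpow_add, mul_assoc]
      rw [← mul_assoc b, hc, mul_assoc]
  have hφ (g : BraidGroup n) : φ g = g * fullTwist n ^ (t * ℓ g) := rfl
  obtain ⟨N, hN, hN6⟩ : ∃ N : ℤ, ℓ (fullTwist n) = N ∧ 6 ≤ N := by
    refine ⟨_, hlen, ?_⟩
    have h2 : (2 : ℤ) ≤ ((n - 1 : ℕ) : ℤ) := by lia
    have h3 : (3 : ℤ) ≤ n := by lia
    nlinarith
  have hℓφ (g : BraidGroup n) : ℓ (φ g) = ℓ g * (1 + t * N) := by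
    rw [hφ, hℓ, hℓpow, hN]; ring
  have htN : 6 ≤ |t * N| := by
    rw [abs_mul]
    have h1 := Int.one_le_abs ht
    have h2 := le_abs_self N
    nlinarith
  have hinj : Function.Injective φ := by
    rw [injective_iff_map_eq_one]
    intro g hg
    have h1 : ℓ (1 : BraidGroup n) = 0 := by simpa using hℓ 1 1
    have h0 : ℓ g * (1 + t * N) = 0 := by rw [← hℓφ, hg, h1]
    have hg0 : ℓ g = 0 := by
      refine (mul_eq_zero.mp h0).resolve_right fun h => ?_
      rw [show t * N = -1 by lia] at htN
      norm_num at htN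
    simpa [hφ, hg0] using hg
  have hsurj : ¬ Function.Surjective φ := by
    intro h
    obtain ⟨g, hg⟩ := h (braidσ n ⟨0, by lia⟩)
    have h1 : ℓ g * (1 + t * N) = 1 := by rw [← hℓφ, hg, hℓσ]
    have hu : 1 + t * N = 1 ∨ 1 + t * N = -1 := Int.isUnit_iff.mp (.of_mul_eq_one_right _ h1)
    rcases abs_cases (t * N) with h | h <;> lia
  exact ⟨φ, fun i => by rw [hφ, hℓσ, mul_one], hφ, hinj, hsurj, fun h => hsurj (h φ hinj)⟩
end

section
/- Let n ≥ 5. There is no injective group homomorphism from M_n to M_{n+1}, where M_n and M_{n+1} are the mapping class groups of the n-punctured and (n+1)-punctured spheres, given by their standard presentations. -/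
/-- Relators for the mapping class group of the `n`-punctured sphere: the braid relators
together with `σ_1⋯σ_{n-1}·σ_{n-1}⋯σ_1` and `(σ_1⋯σ_{n-1})^n`. -/
def sphereRels (n : ℕ) : Set (FreeGroup (Fin (n - 1))) :=
  braidRels (n - 1) ∪
    { (List.ofFn (fun i : Fin (n - 1) => FreeGroup.of i)).prod *
        (List.ofFn (fun i : Fin (n - 1) => FreeGroup.of i)).reverse.prod,
      (List.ofFn (fun i : Fin (n - 1) => FreeGroup.of i)).prod ^ n }

/-- The mapping class group of the `n`-punctured sphere, via its standard presentation. -/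
abbrev SphereMCG (n : ℕ) : Type := PresentedGroup (sphereRels n)

/-! ### Simply laced Artin monoids -/

/-- Equality of words in the simply laced Artin monoid of the graph `adj`. -/
inductive ArtinEq {α : Type*} (adj : α → α → Prop) : List α → List α → Prop
  | refl (u) : ArtinEq adj u u
  | symm {u v} : ArtinEq adj u v → ArtinEq adj v u
  | trans {u v w} : ArtinEq adj u v → ArtinEq adj v w → ArtinEq adj u w
  | cons (a) {u v} : ArtinEq adj u v → ArtinEq adj (a :: u) (a :: v)
  | comm (a b u) : ¬ adj a b → ArtinEq adj (a :: b :: u) (b :: a :: u)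
  | braid (a b u) : adj a b → ArtinEq adj (a :: b :: a :: u) (b :: a :: b :: u)

namespace ArtinEq

variable {α : Type*} {adj : α → α → Prop}

theorem length_eq {u v : List α} (h : ArtinEq adj u v) : u.length = v.length := by
  induction h <;> simp_all

theorem append_left (w : List α) {u v : List α} (h : ArtinEq adj u v) :
    ArtinEq adj (w ++ u) (w ++ v) := by
  induction w with
  | nil => exact h
  | cons a w ih => exact .cons a ih

theorem append_right (w : List α) {u v : List α} (h : ArtinEq adj u v) :
    ArtinEq adj (u ++ w) (v ++ w) := by
  induction h with
  | refl u => exact .refl _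
  | symm _ ih => exact ih.symm
  | trans _ _ ih₁ ih₂ => exact ih₁.trans ih₂
  | cons a _ ih => exact .cons a ih
  | comm a b u h => exact .comm a b _ h
  | braid a b u h => exact .braid a b _ h

/-- Equality of words as a setoid. -/
def setoid (adj : α → α → Prop) : Setoid (List α) :=
  ⟨ArtinEq adj, .refl, .symm, .trans⟩

end ArtinEq

/-- The Artin monoid of a simply laced graph: adjacent generators satisfy the braid relation,
and non-adjacent generators commute. -/
def ArtinMonoid {α : Type*} (adj : α → α → Prop) : Type _ := Quotient (ArtinEq.setoid adj)

namespace ArtinMonoid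

variable {α : Type*} {adj : α → α → Prop}

/-- The element represented by a word. -/
def mk (u : List α) : ArtinMonoid adj := Quotient.mk (ArtinEq.setoid adj) u

theorem mk_eq_mk {u v : List α} : (mk u : ArtinMonoid adj) = mk v ↔ ArtinEq adj u v :=
  ⟨fun h => Quotient.exact h, fun h => Quotient.sound h⟩

instance : Monoid (ArtinMonoid adj) where
  mul x y := Quotient.liftOn₂ x y (fun u v => mk (u ++ v)) fun _ _ _ _ h₁ h₂ =>
    mk_eq_mk.2 ((h₁.append_right _).trans (h₂.append_left _))
  one := mk []
  mul_assoc x y z := by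
    obtain ⟨u, rfl⟩ := Quotient.exists_rep x
    obtain ⟨v, rfl⟩ := Quotient.exists_rep y
    obtain ⟨w, rfl⟩ := Quotient.exists_rep z
    exact congrArg mk (List.append_assoc u v w)
  one_mul x := by
    obtain ⟨u, rfl⟩ := Quotient.exists_rep x
    rfl
  mul_one x := by
    obtain ⟨u, rfl⟩ := Quotient.exists_rep x
    exact congrArg mk (List.append_nil u)

/-- The generators. -/
def gen (a : α) : ArtinMonoid adj := mk [a]

theorem mk_cons (a : α) (u : List α) : (mk (a :: u) : ArtinMonoid adj) = gen a * mk u := rfl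

theorem gen_comm {a b : α} (h : ¬ adj a b) :
    (gen a * gen b : ArtinMonoid adj) = gen b * gen a :=
  mk_eq_mk.2 (.comm a b [] h)

theorem gen_braid {a b : α} (h : adj a b) :
    (gen a * gen b * gen a : ArtinMonoid adj) = gen b * gen a * gen b :=
  mk_eq_mk.2 (.braid a b [] h)

@[elab_as_elim]
theorem induction {p : ArtinMonoid adj → Prop} (one : p 1)
    (gen_mul : ∀ a x, p x → p (gen a * x)) (x : ArtinMonoid adj) : p x := by
  obtain ⟨u, rfl⟩ := Quotient.exists_rep x
  induction u with
  | nil => exact one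
  | cons a u ih => exact gen_mul a _ ih

theorem eq_one_or_eq_gen_mul (x : ArtinMonoid adj) : x = 1 ∨ ∃ a y, x = gen a * y := by
  induction x using induction with
  | one => exact .inl rfl
  | gen_mul a x _ => exact .inr ⟨a, x, rfl⟩

/-- The word length. -/
def length (x : ArtinMonoid adj) : ℕ := Quotient.liftOn x List.length fun _ _ h => h.length_eq

@[simp] theorem length_mk (u : List α) : (mk u : ArtinMonoid adj).length = u.length := rfl

@[simp] theorem length_one : (1 : ArtinMonoid adj).length = 0 := rfl

@[simp] theorem length_gen (a : α) : (gen a : ArtinMonoid adj).length = 1 := rfl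

@[simp] theorem length_mul (x y : ArtinMonoid adj) : (x * y).length = x.length + y.length := by
  obtain ⟨u, rfl⟩ := Quotient.exists_rep x
  obtain ⟨v, rfl⟩ := Quotient.exists_rep y
  exact List.length_append

@[simp] theorem length_pow (x : ArtinMonoid adj) (k : ℕ) : (x ^ k).length = k * x.length := by
  induction k with
  | zero => simp
  | succ k ih => rw [pow_succ, length_mul, ih, Nat.succ_mul]

theorem eq_one_of_length_eq_zero {x : ArtinMonoid adj} (h : x.length = 0) : x = 1 := by
  obtain rfl | ⟨a, y, rfl⟩ := eq_one_or_eq_gen_mul x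
  · rfl
  · simp at h

/-- The homomorphism to a monoid `N` given by elements satisfying the defining relations. -/
def lift {N : Type*} [Monoid N] (f : α → N) (hc : ∀ a b, ¬ adj a b → f a * f b = f b * f a)
    (hb : ∀ a b, adj a b → f a * f b * f a = f b * f a * f b) : ArtinMonoid adj →* N where
  toFun x := Quotient.liftOn x (fun u => (u.map f).prod) fun u v h => by
    induction h with
    | refl u => rfl
    | symm _ ih => exact ih.symm
    | trans _ _ ih₁ ih₂ => exact ih₁.trans ih₂
    | cons a _ ih => simpa using congrArg (f a * ·) ih
    | comm a b u h => simp [← mul_assoc, hc a b h]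
    | braid a b u h => simp [← mul_assoc, hb a b h]
  map_one' := rfl
  map_mul' x y := by
    obtain ⟨u, rfl⟩ := Quotient.exists_rep x
    obtain ⟨v, rfl⟩ := Quotient.exists_rep y
    change ((u ++ v).map f).prod = (u.map f).prod * (v.map f).prod
    simp

@[simp] theorem lift_gen {N : Type*} [Monoid N] (f : α → N)
    (hc : ∀ a b, ¬ adj a b → f a * f b = f b * f a)
    (hb : ∀ a b, adj a b → f a * f b * f a = f b * f a * f b) (a : α) :
    lift f hc hb (gen a) = f a :=
  List.prod_singleton

open Classical in
/-- The element `compl a b` such that `gen a * compl a b` is the least common multiple of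
`gen a` and `gen b`. -/
noncomputable def compl (a b : α) : ArtinMonoid adj :=
  if a = b then 1 else if adj a b then gen b * gen a else gen b

theorem compl_self (a : α) : (compl a a : ArtinMonoid adj) = 1 := if_pos rfl

theorem compl_adj {a b : α} (hne : a ≠ b) (h : adj a b) :
    (compl a b : ArtinMonoid adj) = gen b * gen a := by
  rw [compl, if_neg hne, if_pos h]

theorem compl_not_adj {a b : α} (hne : a ≠ b) (h : ¬ adj a b) :
    (compl a b : ArtinMonoid adj) = gen b := by
  rw [compl, if_neg hne, if_neg h]

theorem gen_mul_compl (hs : ∀ a b, adj a b → adj b a) (a b : α) :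
    (gen a * compl a b : ArtinMonoid adj) = gen b * compl b a := by
  by_cases hab : a = b
  · rw [hab]
  by_cases h : adj a b
  · rw [compl_adj hab h, compl_adj (Ne.symm hab) (hs _ _ h), ← mul_assoc, ← mul_assoc,
      gen_braid h]
  · rw [compl_not_adj hab h, compl_not_adj (Ne.symm hab) fun h' => h (hs _ _ h'), gen_comm h]

/-- `HeadRel a U b V` says that `gen a * U` and `gen b * V` are equal for the obvious reason that
`U` and `V` have a common cofactor after completing `a` and `b` to their common multiple. -/
def HeadRel (a : α) (U : ArtinMonoid adj) (b : α) (V : ArtinMonoid adj) : Prop :=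
  ∃ Z, U = compl a b * Z ∧ V = compl b a * Z

theorem HeadRel.symm {a b : α} {U V : ArtinMonoid adj} (h : HeadRel a U b V) :
    HeadRel b V a U :=
  let ⟨Z, h₁, h₂⟩ := h
  ⟨Z, h₂, h₁⟩

section Transitivity

variable {n : ℕ} (ih : ∀ (a b : α) (U V : ArtinMonoid adj), U.length < n →
  gen a * U = gen b * V → HeadRel a U b V)

include ih

theorem gen_cancel_of_length {a : α} {U V : ArtinMonoid adj} (hU : U.length < n)
    (h : gen a * U = gen a * V) : U = V := by
  obtain ⟨Z, rfl, rfl⟩ := ih a a U V hU h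
  rfl

theorem exists_of_adj {a b : α} (hne : a ≠ b) (h₁ : adj a b) (h₂ : adj b a)
    {U V : ArtinMonoid adj} (hU : U.length < n) (h : gen a * U = gen b * V) :
    ∃ Z, U = gen b * (gen a * Z) ∧ V = gen a * (gen b * Z) := by
  obtain ⟨Z, rfl, rfl⟩ := ih a b U V hU h
  exact ⟨Z, by rw [compl_adj hne h₁, mul_assoc], by rw [compl_adj hne.symm h₂, mul_assoc]⟩

theorem exists_of_not_adj {a b : α} (hne : a ≠ b) (h₁ : ¬ adj a b) (h₂ : ¬ adj b a)
    {U V : ArtinMonoid adj} (hU : U.length < n) (h : gen a * U = gen b * V) :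
    ∃ Z, U = gen b * Z ∧ V = gen a * Z := by
  obtain ⟨Z, rfl, rfl⟩ := ih a b U V hU h
  exact ⟨Z, by rw [compl_not_adj hne h₁], by rw [compl_not_adj hne.symm h₂]⟩


theorem HeadRel.trans_of_adj_left (hs : ∀ a b, adj a b → adj b a)
    (ht : ∀ a b c, adj a b → adj b c → ¬ adj a c) {a p b : α} {U C V : ArtinMonoid adj}
    (hap : a ≠ p) (hpb : p ≠ b) (hab : a ≠ b) (hadj : adj p a) (hC : C.length = n)
    (h₁ : HeadRel a U p C) (h₂ : HeadRel p C b V) : HeadRel a U b V := by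
  have gb : ∀ {x y : α} (Z : ArtinMonoid adj), adj x y →
      gen x * (gen y * (gen x * Z)) = gen y * (gen x * (gen y * Z)) := fun Z h => by
    rw [← mul_assoc, ← mul_assoc, gen_braid h, mul_assoc, mul_assoc]
  have gc : ∀ {x y : α} (Z : ArtinMonoid adj), ¬ adj x y →
      gen x * (gen y * Z) = gen y * (gen x * Z) := fun Z h => by
    rw [← mul_assoc, gen_comm h, mul_assoc]
  have hadj' := hs _ _ hadj
  obtain ⟨Z, rfl, hCZ⟩ := h₁
  obtain ⟨Z', hCZ', rfl⟩ := h₂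
  subst hCZ
  rw [compl_adj hap.symm hadj, mul_assoc] at hCZ' hC
  rw [compl_adj hap hadj', mul_assoc]
  simp only [length_mul, length_gen] at hC
  by_cases hpb' : adj p b
  · have hab' : ¬ adj a b := ht _ _ _ hadj' hpb'
    have hba' : ¬ adj b a := fun h => hab' (hs _ _ h)
    have hbp' := hs _ _ hpb'
    rw [compl_adj hpb hpb', mul_assoc] at hCZ'
    rw [compl_adj hpb.symm hbp', mul_assoc]
    obtain ⟨W, hW₁, hW₂⟩ := exists_of_not_adj ih hab hab' hba'
      (by simp only [length_mul, length_gen]; omega) hCZ'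
    have l₁ := congrArg length hW₁
    have l₂ := congrArg length hW₂
    simp only [length_mul, length_gen] at l₁ l₂
    obtain ⟨X, rfl, rfl⟩ := exists_of_adj ih hpb hpb' hbp' (by omega) hW₁
    obtain ⟨Y, rfl, hY⟩ := exists_of_adj ih hap.symm hadj hadj' (by omega) hW₂
    simp only [length_mul, length_gen] at hC l₁ l₂
    have hY' := gen_cancel_of_length ih
      (by simp only [length_mul, length_gen]; omega) hY
    obtain ⟨T, rfl, rfl⟩ := exists_of_not_adj ih hab.symm hba' hab' (by omega) hY'
    refine ⟨gen p * (gen b * (gen a * (gen p * T))), ?_, ?_⟩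
    · rw [compl_not_adj hab hab', gc _ hab', gb _ hadj', gb _ hpb']
    · rw [compl_not_adj hab.symm hba', gc _ hba', gb _ hbp', gb _ hadj, gc _ hab']
  · have hbp' : ¬ adj b p := fun h => hpb' (hs _ _ h)
    rw [compl_not_adj hpb hpb'] at hCZ'
    rw [compl_not_adj hpb.symm hbp']
    by_cases hab' : adj a b
    · have hba' := hs _ _ hab'
      obtain ⟨W, hW, rfl⟩ := exists_of_adj ih hab hab' hba'
        (by simp only [length_mul, length_gen]; omega) hCZ'
      have l := congrArg length hW
      simp only [length_mul, length_gen] at l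
      obtain ⟨X, rfl, hX⟩ := exists_of_not_adj ih hpb hpb' hbp' (by omega) hW
      simp only [length_mul, length_gen] at hC l
      obtain ⟨Y, rfl, rfl⟩ := exists_of_adj ih hap hadj' hadj
        (by omega) hX
      refine ⟨gen p * (gen a * (gen b * Y)), ?_, ?_⟩
      · rw [compl_adj hab hab', mul_assoc, gb _ hab', gc Y hbp', gc _ hpb', gb _ hadj]
      · rw [compl_adj hab.symm hba', mul_assoc, gc _ hbp', gb _ hadj, gb Y hab', gc _ hpb']
    · have hba' : ¬ adj b a := fun h => hab' (hs _ _ h)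
      obtain ⟨W, hW, rfl⟩ := exists_of_not_adj ih hab hab' hba'
        (by simp only [length_mul, length_gen]; omega) hCZ'
      have l := congrArg length hW
      simp only [length_mul, length_gen] at l
      obtain ⟨X, rfl, rfl⟩ := exists_of_not_adj ih hpb hpb' hbp' (by omega) hW
      refine ⟨gen p * (gen a * X), ?_, ?_⟩
      · rw [compl_not_adj hab hab', gc _ hab', gc _ hpb']
      · rw [compl_not_adj hab.symm hba', gb _ hadj]

theorem HeadRel.trans (hs : ∀ a b, adj a b → adj b a)
    (ht : ∀ a b c, adj a b → adj b c → ¬ adj a c) {a p b : α} {U C V : ArtinMonoid adj}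
    (hC : C.length = n) (h₁ : HeadRel a U p C) (h₂ : HeadRel p C b V) : HeadRel a U b V := by
  by_cases hap : a = p
  · subst hap
    obtain ⟨Z, rfl, rfl⟩ := h₁
    exact h₂
  by_cases hpb : p = b
  · subst hpb
    obtain ⟨Z, rfl, rfl⟩ := h₂
    exact h₁
  by_cases hab : a = b
  · subst hab
    obtain ⟨Z, rfl, hZ⟩ := h₁
    obtain ⟨Z', rfl, rfl⟩ := h₂
    suffices Z' = Z from ⟨compl a p * Z, by rw [compl_self, one_mul], by
      rw [this, compl_self, one_mul]⟩
    by_cases h : adj p a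
    · simp only [compl_adj hpb h, mul_assoc, length_mul, length_gen] at hZ hC
      exact gen_cancel_of_length ih (by omega) (gen_cancel_of_length ih
        (by simp only [length_mul, length_gen]; omega) hZ)
    · simp only [compl_not_adj hpb h, length_mul, length_gen] at hZ hC
      exact gen_cancel_of_length ih (by omega) hZ
  by_cases h : adj p a
  · exact trans_of_adj_left ih hs ht hap hpb hab h hC h₁ h₂
  by_cases h' : adj p b
  · exact (trans_of_adj_left ih hs ht (Ne.symm hpb) (Ne.symm hap) (Ne.symm hab) h' hC
      h₂.symm h₁.symm).symm
  have hap' : ¬ adj a p := fun h'' => h (hs _ _ h'')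
  have hbp' : ¬ adj b p := fun h'' => h' (hs _ _ h'')
  obtain ⟨Z, rfl, hCZ⟩ := h₁
  obtain ⟨Z', hCZ', rfl⟩ := h₂
  subst hCZ
  rw [compl_not_adj (Ne.symm hap) h] at hC hCZ'
  rw [compl_not_adj hpb h'] at hCZ'
  simp only [length_mul, length_gen] at hC
  obtain ⟨W, rfl, rfl⟩ := ih a b Z Z' (by omega) hCZ'
  have key : ∀ {x y : α} (_ : ¬ adj x p) (_ : ¬ adj y p),
      (gen p * (compl x y * W) : ArtinMonoid adj) = compl x y * (gen p * W) := by
    intro x y hx hy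
    by_cases hxy : x = y
    · rw [hxy, compl_self, one_mul, one_mul]
    by_cases hxy' : adj x y
    · rw [compl_adj hxy hxy', mul_assoc, mul_assoc, ← mul_assoc (gen p), ← gen_comm hy,
        mul_assoc, ← mul_assoc (gen p), ← gen_comm hx, mul_assoc]
    · rw [compl_not_adj hxy hxy', ← mul_assoc, ← gen_comm hy, mul_assoc]
  exact ⟨gen p * W, by rw [compl_not_adj hap hap', key hap' hbp'], by
    rw [compl_not_adj (Ne.symm hpb) hbp', key hbp' hap']⟩

end Transitivity

/-- The relation `HeadRel` on words. -/
def WordRel : List α → List α → Prop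
  | [], [] => True
  | a :: u, b :: v => HeadRel a (mk u : ArtinMonoid adj) b (mk v)
  | _, _ => False

section

variable (hs : ∀ a b, adj a b → adj b a) (ht : ∀ a b c, adj a b → adj b c → ¬ adj a c)

include hs ht

theorem headRel_of_length_lt (n : ℕ) : ∀ (a b : α) (U V : ArtinMonoid adj), U.length < n →
    gen a * U = gen b * V → HeadRel a U b V := by
  induction n with
  | zero => intro _ _ _ _ h; simp at h
  | succ n ih =>
    have key : ∀ {u v : List α}, ArtinEq adj u v → u.length ≤ n + 1 →
        WordRel (adj := adj) u v := by
      intro u v h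
      induction h with
      | refl u =>
        intro _
        cases u with
        | nil => trivial
        | cons a u => exact ⟨mk u, by rw [compl_self, one_mul], by rw [compl_self, one_mul]⟩
      | @symm u v h ihh =>
        intro hl
        have := ihh (h.length_eq ▸ hl)
        cases u <;> cases v <;> first | exact this | exact HeadRel.symm this
      | @trans u v w h₁ h₂ ih₁ ih₂ =>
        intro hl
        have l₁ := h₁.length_eq
        have r₁ := ih₁ hl
        have r₂ := ih₂ (l₁ ▸ hl)
        rcases u with _ | ⟨a, u⟩ <;> rcases v with _ | ⟨p, v⟩ <;> rcases w with _ | ⟨b, w⟩ <;>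
          try first | trivial | exact r₁.elim | exact r₂.elim
        simp only [List.length_cons] at hl l₁
        obtain hlt | heq := Nat.lt_or_ge u.length n
        · exact ih _ _ _ _ hlt (mk_eq_mk.2 (h₁.trans h₂))
        · exact HeadRel.trans ih hs ht (by rw [length_mk]; omega) r₁ r₂
      | @cons a u v h _ =>
        intro _
        exact ⟨mk v, by rw [compl_self, one_mul, mk_eq_mk.2 h], by rw [compl_self, one_mul]⟩
      | comm a b u h =>
        intro _
        by_cases hab : a = b
        · subst hab
          exact ⟨mk (a :: u), by rw [compl_self, one_mul], by rw [compl_self, one_mul]⟩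
        · exact ⟨mk u, by rw [compl_not_adj hab h, mk_cons], by
            rw [compl_not_adj (Ne.symm hab) fun h' => h (hs _ _ h'), mk_cons]⟩
      | braid a b u h =>
        intro _
        have hab : a ≠ b := by
          rintro rfl
          exact ht _ _ _ h h h
        exact ⟨mk u, by rw [compl_adj hab h, mk_cons, mk_cons, mul_assoc], by
          rw [compl_adj hab.symm (hs _ _ h), mk_cons, mk_cons, mul_assoc]⟩
    intro a b U V hl h
    obtain ⟨u, rfl⟩ := Quotient.exists_rep U
    obtain ⟨v, rfl⟩ := Quotient.exists_rep V
    refine key (u := a :: u) (v := b :: v) (mk_eq_mk.1 h) ?_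
    have : u.length < n + 1 := hl
    simpa using this

/-- **Garside's theorem**: an equality `gen a * U = gen b * V` factors through the least common
multiple of `gen a` and `gen b`. -/
theorem headRel_of_eq {a b : α} {U V : ArtinMonoid adj} (h : gen a * U = gen b * V) :
    HeadRel a U b V :=
  headRel_of_length_lt hs ht (U.length + 1) a b U V (Nat.lt_succ_self _) h

theorem mul_left_cancel_of_triangleFree {x U V : ArtinMonoid adj} (h : x * U = x * V) :
    U = V := by
  induction x using induction with
  | one => simpa using h
  | gen_mul a x ih =>
    rw [mul_assoc, mul_assoc] at h
    obtain ⟨Z, h₁, h₂⟩ := headRel_of_eq hs ht h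
    exact ih (h₁.trans h₂.symm)

/-- Elements with a common right multiple have a least one. -/
theorem exists_lcm_of_dvd (n : ℕ) : ∀ X A B : ArtinMonoid adj, X.length = n → A ∣ X → B ∣ X →
    ∃ L, A ∣ L ∧ B ∣ L ∧ ∀ C, A ∣ C → B ∣ C → L ∣ C := by
  have cancel {x U V : ArtinMonoid adj} (h : x * U = x * V) : U = V :=
    mul_left_cancel_of_triangleFree hs ht h
  have dvd_cancel {x U V : ArtinMonoid adj} (h : x * U ∣ x * V) : U ∣ V := by
    obtain ⟨W, hW⟩ := h
    exact ⟨W, cancel (hW.trans (mul_assoc _ _ _))⟩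
  induction n using Nat.strong_induction_on with
  | _ n ih =>
    intro X A B hX hA hB
    obtain rfl | ⟨a, A, rfl⟩ := eq_one_or_eq_gen_mul A
    · exact ⟨B, one_dvd _, dvd_rfl, fun C _ h => h⟩
    obtain rfl | ⟨b, B, rfl⟩ := eq_one_or_eq_gen_mul B
    · exact ⟨gen a * A, dvd_rfl, one_dvd _, fun C h _ => h⟩
    obtain ⟨Xa, hXa⟩ := hA
    obtain ⟨Xb, hXb⟩ := hB
    rw [mul_assoc] at hXa hXb
    have split {C : ArtinMonoid adj} (h₁ : gen a * A ∣ C) (h₂ : gen b * B ∣ C) :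
        ∃ D, C = gen a * compl a b * D ∧ A ∣ compl a b * D ∧ B ∣ compl b a * D := by
      obtain ⟨C₁, rfl⟩ := h₁
      obtain ⟨C₂, hC₂⟩ := h₂
      rw [mul_assoc, mul_assoc] at hC₂
      obtain ⟨D, hD₁, hD₂⟩ := headRel_of_eq hs ht hC₂
      exact ⟨D, by rw [mul_assoc, mul_assoc, hD₁], ⟨C₁, hD₁.symm⟩, ⟨C₂, hD₂.symm⟩⟩
    obtain ⟨D, hD, hD₁, hD₂⟩ := split (C := X) ⟨Xa, by rw [mul_assoc, hXa]⟩
      ⟨Xb, by rw [mul_assoc, hXb]⟩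
    have hl₁ : (compl a b * D).length < n := by
      rw [← hX, hD, mul_assoc]; simp
    have hl₂ : (compl b a * D).length < n := by
      rw [← hX, hD, gen_mul_compl hs, mul_assoc]; simp
    obtain ⟨L₁, hAL, ⟨F, rfl⟩, hF⟩ := ih _ hl₁ _ A (compl a b) rfl hD₁ (dvd_mul_right _ _)
    obtain ⟨L₂, hBL, ⟨G, rfl⟩, hG⟩ := ih _ hl₂ _ B (compl b a) rfl hD₂ (dvd_mul_right _ _)
    have hlD : D.length < n := by
      have := length_mul (compl a b) D
      omega
    obtain ⟨L, hFL, hGL, hL⟩ := ih _ hlD D F G rfl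
      (dvd_cancel (hF _ hD₁ (dvd_mul_right _ _))) (dvd_cancel (hG _ hD₂ (dvd_mul_right _ _)))
    refine ⟨gen a * compl a b * L, ?_, ?_, ?_⟩
    · rw [mul_assoc]
      exact mul_dvd_mul_left _ (hAL.trans (mul_dvd_mul_left _ hFL))
    · rw [gen_mul_compl hs, mul_assoc]
      exact mul_dvd_mul_left _ (hBL.trans (mul_dvd_mul_left _ hGL))
    · intro C h₁ h₂
      obtain ⟨E, rfl, hE₁, hE₂⟩ := split h₁ h₂
      exact mul_dvd_mul_left _ (hL _ (dvd_cancel (hF _ hE₁ (dvd_mul_right _ _)))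
        (dvd_cancel (hG _ hE₂ (dvd_mul_right _ _))))

/-- A finite family of elements with a common right multiple has a least one. -/
theorem exists_lcm_family (f : ℕ → ArtinMonoid adj) (X : ArtinMonoid adj) (k : ℕ)
    (hX : ∀ i < k, f i ∣ X) :
    ∃ L, (∀ i < k, f i ∣ L) ∧ ∀ C, (∀ i < k, f i ∣ C) → L ∣ C := by
  induction k with
  | zero => exact ⟨1, by simp, fun C _ => one_dvd C⟩
  | succ k ih =>
    obtain ⟨L, hL₁, hL₂⟩ := ih fun i hi => hX i (hi.trans (Nat.lt_succ_self k))
    obtain ⟨L', h₁, h₂, h₃⟩ := exists_lcm_of_dvd hs ht _ X L (f k) rfl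
      (hL₂ X fun i hi => hX i (hi.trans (Nat.lt_succ_self k))) (hX k (Nat.lt_succ_self k))
    refine ⟨L', fun i hi => ?_, fun C hC => h₃ C (hL₂ C fun i hi => hC i (by omega))
      (hC k (Nat.lt_succ_self k))⟩
    obtain hi | rfl := Nat.lt_succ_iff_lt_or_eq.1 hi
    · exact (hL₁ i hi).trans h₁
    · exact h₂

end

end ArtinMonoid

/-! ### Sequences satisfying the braid relations -/

/-- The elements `s 0, …, s (m - 1)` satisfy the braid relations. -/
structure IsBraidSeq {M : Type*} [Monoid M] (m : ℕ) (s : ℕ → M) : Prop where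
  braid : ∀ i, i + 1 < m → s i * s (i + 1) * s i = s (i + 1) * s i * s (i + 1)
  comm : ∀ i j, i + 2 ≤ j → j < m → s i * s j = s j * s i

/-- The product `s 0 * s 1 * ⋯ * s (k - 1)`. -/
def upProd {M : Type*} [Monoid M] (s : ℕ → M) : ℕ → M
  | 0 => 1
  | k + 1 => upProd s k * s k

/-- The product `s (k - 1) * ⋯ * s 1 * s 0`. -/
def downProd {M : Type*} [Monoid M] (s : ℕ → M) : ℕ → M
  | 0 => 1
  | k + 1 => s k * downProd s k

/-- The product `s k * s (k - 1) * ⋯ * s (k - j + 1)` of `j` factors. -/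
def descProd {M : Type*} [Monoid M] (s : ℕ → M) (k : ℕ) : ℕ → M
  | 0 => 1
  | j + 1 => descProd s k j * s (k - j)

section Monoid

variable {M : Type*} [Monoid M]

@[simp] theorem upProd_zero (s : ℕ → M) : upProd s 0 = 1 := rfl

theorem upProd_succ (s : ℕ → M) (k : ℕ) : upProd s (k + 1) = upProd s k * s k := rfl

@[simp] theorem downProd_zero (s : ℕ → M) : downProd s 0 = 1 := rfl

theorem downProd_succ (s : ℕ → M) (k : ℕ) : downProd s (k + 1) = s k * downProd s k := rfl

theorem upProd_succ' (s : ℕ → M) (k : ℕ) :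
    upProd s (k + 1) = s 0 * upProd (fun i => s (i + 1)) k := by
  induction k with
  | zero => simp [upProd]
  | succ k ih => rw [upProd_succ, ih, upProd_succ, mul_assoc]

theorem map_upProd {N : Type*} [Monoid N] (f : M →* N) (s : ℕ → M) (k : ℕ) :
    f (upProd s k) = upProd (fun i => f (s i)) k := by
  induction k with
  | zero => simp
  | succ k ih => rw [upProd_succ, map_mul, ih, upProd_succ]

theorem map_downProd {N : Type*} [Monoid N] (f : M →* N) (s : ℕ → M) (k : ℕ) :
    f (downProd s k) = downProd (fun i => f (s i)) k := by
  induction k with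
  | zero => simp
  | succ k ih => rw [downProd_succ, map_mul, ih, downProd_succ]

theorem upProd_congr {s t : ℕ → M} {k : ℕ} (h : ∀ i < k, s i = t i) :
    upProd s k = upProd t k := by
  induction k with
  | zero => rfl
  | succ k ih => rw [upProd_succ, upProd_succ, ih fun i hi => h i (by omega), h k (by omega)]

theorem prod_ofFn_eq_upProd (s : ℕ → M) (m : ℕ) :
    (List.ofFn fun i : Fin m => s i).prod = upProd s m := by
  induction m with
  | zero => simp
  | succ m ih => rw [List.ofFn_succ', List.concat_eq_append, List.prod_append]; simp [ih, upProd]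

theorem prod_reverse_ofFn_eq_downProd (s : ℕ → M) (m : ℕ) :
    (List.ofFn fun i : Fin m => s i).reverse.prod = downProd s m := by
  induction m with
  | zero => simp
  | succ m ih =>
    rw [List.ofFn_succ', List.concat_eq_append, List.reverse_append, List.prod_append]
    simp [ih, downProd]

theorem descProd_succ' (s : ℕ → M) (k j : ℕ) :
    descProd s (k + 1) (j + 1) = s (k + 1) * descProd s k j := by
  induction j with
  | zero => simp [descProd]
  | succ j ih => rw [descProd, ih, descProd, mul_assoc, Nat.add_sub_add_right]

theorem descProd_eq_downProd (s : ℕ → M) (k : ℕ) : descProd s k (k + 1) = downProd s (k + 1) := by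
  induction k with
  | zero => simp [descProd, downProd]
  | succ k ih => rw [descProd_succ', ih, ← downProd_succ]

theorem commute_upProd {s : ℕ → M} {x : M} {k : ℕ} (h : ∀ i < k, Commute x (s i)) :
    Commute x (upProd s k) := by
  induction k with
  | zero => exact Commute.one_right x
  | succ k ih => exact (ih fun i hi => h i (by omega)).mul_right (h k (by omega))

namespace IsBraidSeq

variable {m : ℕ} {s : ℕ → M}

theorem map {N : Type*} [Monoid N] (hs : IsBraidSeq m s) (f : M →* N) :
    IsBraidSeq m fun i => f (s i) :=
  ⟨fun i hi => by simpa only [map_mul] using congrArg f (hs.braid i hi),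
    fun i j hij hj => by simpa only [map_mul] using congrArg f (hs.comm i j hij hj)⟩

theorem mono (hs : IsBraidSeq m s) {k : ℕ} (hk : k ≤ m) : IsBraidSeq k s :=
  ⟨fun i hi => hs.braid i (by omega), fun i j hij hj => hs.comm i j hij (by omega)⟩

theorem commute (hs : IsBraidSeq m s) {i j : ℕ} (hi : i < m) (hj : j < m)
    (h : i + 2 ≤ j ∨ j + 2 ≤ i) : Commute (s i) (s j) :=
  h.elim (fun h => hs.comm i j h hj) fun h => (hs.comm j i h hi).symm

theorem upProd_mul (hs : IsBraidSeq m s) {i k : ℕ} (hi : i + 1 < k) (hk : k ≤ m) :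
    upProd s k * s i = s (i + 1) * upProd s k := by
  induction k with
  | zero => omega
  | succ k ih =>
    obtain h | rfl : i + 1 < k ∨ k = i + 1 := by omega
    · rw [upProd_succ, mul_assoc, (hs.commute (i := k) (j := i) (by omega) (by omega)
        (by omega)).eq, ← mul_assoc, ih h (by omega), mul_assoc]
    · have hc : Commute (s (i + 1)) (upProd s i) :=
        commute_upProd fun j hj => hs.commute (by omega) (by omega) (by omega)
      rw [upProd_succ, upProd_succ, mul_assoc, mul_assoc, ← mul_assoc (s i), hs.braid i (by omega),
        ← mul_assoc, ← mul_assoc, ← mul_assoc, ← hc.eq]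
      simp only [mul_assoc]

theorem upProd_mul_upProd (hs : IsBraidSeq m s) {k j : ℕ} (hj : j ≤ k) (hk : k + 1 ≤ m) :
    upProd s (k + 1) * upProd s j = upProd (fun i => s (i + 1)) j * upProd s (k + 1) := by
  induction j with
  | zero => simp
  | succ j ih =>
    rw [upProd_succ s j, ← mul_assoc, ih (by omega), mul_assoc, hs.upProd_mul (by omega) hk,
      upProd_succ (fun i => s (i + 1)) j, mul_assoc]

theorem upProd_sq_mul (hs : IsBraidSeq m s) {k : ℕ} (hk : k + 1 ≤ m) :
    upProd s (k + 1) ^ 2 * s k = s 0 * upProd s (k + 1) ^ 2 := by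
  have h : upProd s (k + 1) ^ 2 = upProd (fun i => s (i + 1)) k * upProd s (k + 1) * s k := by
    rw [← hs.upProd_mul_upProd le_rfl hk, sq, mul_assoc, ← upProd_succ]
  conv_rhs => rw [h, ← mul_assoc, ← mul_assoc, ← upProd_succ', ← sq]

theorem upProd_pow_mul (hs : IsBraidSeq m s) {i j : ℕ} (hij : i + j < m) :
    upProd s m ^ j * s i = s (i + j) * upProd s m ^ j := by
  induction j with
  | zero => simp
  | succ j ih =>
    rw [pow_succ', mul_assoc, ih (by omega), ← mul_assoc, hs.upProd_mul (by omega) le_rfl,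
      mul_assoc, add_assoc]

/-- The full twist is central. -/
theorem commute_fullTwist (hs : IsBraidSeq m s) {i : ℕ} (hi : i < m) :
    Commute (upProd s m ^ (m + 1)) (s i) := by
  obtain ⟨k, rfl⟩ : ∃ k, m = i + 1 + k := ⟨m - (i + 1), by omega⟩
  have h₁ := hs.upProd_pow_mul (i := i) (j := k) (by omega)
  have h₂ : upProd s (i + 1 + k) ^ 2 * s (i + k) = s 0 * upProd s (i + 1 + k) ^ 2 := by
    rw [show i + 1 + k = i + k + 1 by omega] at hs ⊢
    exact hs.upProd_sq_mul le_rfl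
  have h₃ := hs.upProd_pow_mul (i := 0) (j := i) (by omega)
  rw [zero_add] at h₃
  rw [Commute, SemiconjBy, show i + 1 + k + 1 = i + (2 + k) by omega, pow_add, pow_add, mul_assoc,
    mul_assoc, h₁, ← mul_assoc (_ ^ 2), h₂, mul_assoc, ← mul_assoc (_ ^ i), h₃, mul_assoc]

theorem commute_fullTwist_of_le (hs : IsBraidSeq m s) {i k : ℕ} (hi : i < k) (hk : k ≤ m) :
    Commute (upProd s k ^ (k + 1)) (s i) :=
  (hs.mono hk).commute_fullTwist hi

theorem dvd_fullTwist (hs : IsBraidSeq m s) {i : ℕ} (hi : i < m) :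
    s i ∣ upProd s m ^ (m + 1) := by
  obtain ⟨k, rfl⟩ : ∃ k, m = k + 1 := ⟨m - 1, by omega⟩
  have h := hs.upProd_pow_mul (i := 0) (j := i) (by omega)
  rw [zero_add] at h
  refine Dvd.dvd.trans ?_ (pow_dvd_pow _ (show i + 1 ≤ k + 1 + 1 by omega))
  rw [pow_succ, upProd_succ', ← mul_assoc, ← upProd_succ', h, mul_assoc]
  exact dvd_mul_right _ _

theorem descProd_mul_upProd (hs : IsBraidSeq m s) {k j : ℕ} (hk : k + 1 < m) (hj : j ≤ k + 1) :
    descProd s (k + 1) j * upProd s (k + 2) = upProd s (k + 2) * descProd s k j := by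
  induction j with
  | zero => simp [descProd]
  | succ j ih =>
    have h := hs.upProd_mul (i := k - j) (k := k + 2) (by omega) (by omega)
    rw [descProd, descProd, mul_assoc, show k + 1 - j = k - j + 1 by omega, ← h, ← mul_assoc,
      ih (by omega), mul_assoc]

theorem upProd_succ_pow (hs : IsBraidSeq m s) {k j : ℕ} (hk : k < m) (hj : j ≤ k + 1) :
    upProd s (k + 1) ^ j = upProd s k ^ j * descProd s k j := by
  obtain _ | k := k
  · obtain rfl | rfl : j = 0 ∨ j = 1 := by omega
    · simp [descProd]
    · simp [descProd, upProd]
  induction j with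
  | zero => simp [descProd]
  | succ j ih =>
    rw [pow_succ, ih (by omega), mul_assoc, hs.descProd_mul_upProd hk (by omega),
      upProd_succ s (k + 1), pow_succ, descProd_succ', mul_assoc, mul_assoc]

/-- The full twist on `k + 2` strands is the full twist on `k + 1` strands followed by a
full turn of the last strand. -/
theorem fullTwist_succ (hs : IsBraidSeq m s) {k : ℕ} (hk : k < m) :
    upProd s (k + 1) ^ (k + 2) =
      upProd s k ^ (k + 1) * (downProd s (k + 1) * upProd s (k + 1)) := by
  rw [pow_succ, hs.upProd_succ_pow hk le_rfl, descProd_eq_downProd, mul_assoc]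

end IsBraidSeq

end Monoid

namespace IsBraidSeq

variable {G : Type*} [Group G] {m : ℕ} {s : ℕ → G}

theorem commute_down_mul_up (hs : IsBraidSeq m s) {i k : ℕ} (hi : i + 1 < k) (hk : k ≤ m) :
    Commute (downProd s k * upProd s k) (s i) := by
  obtain ⟨k, rfl⟩ : ∃ l, k = l + 1 := ⟨k - 1, by omega⟩
  rw [← inv_mul_eq_of_eq_mul (hs.fullTwist_succ (k := k) (by omega))]
  exact (hs.commute_fullTwist_of_le (by omega) (by omega)).inv_left.mul_left
    (hs.commute_fullTwist_of_le (by omega) (by omega))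

/-- The pure braid moving strand `i` once around all the others. -/
def turn (m : ℕ) (s : ℕ → G) (i : ℕ) : G :=
  (upProd s i)⁻¹ * (upProd s m * downProd s m) * upProd s i

theorem turn_mul (s : ℕ → G) (i : ℕ) : turn m s i * s i = s i * turn m s (i + 1) := by
  simp only [turn, upProd_succ]
  group

theorem turn_self (s : ℕ → G) : turn m s m = downProd s m * upProd s m := by
  simp only [turn]
  group

theorem commute_turn_zero (hs : IsBraidSeq m s) {i : ℕ} (hi : i + 1 < m) :
    Commute (upProd s m * downProd s m) (s (i + 1)) := by
  have h₁ := hs.upProd_mul hi le_rfl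
  have h₂ := (hs.commute_down_mul_up hi le_rfl).eq
  rw [Commute, SemiconjBy]
  refine mul_right_cancel (b := upProd s m) ?_
  rw [mul_assoc, ← h₁, mul_assoc, ← mul_assoc (downProd s m), h₂, ← mul_assoc, h₁]
  simp only [mul_assoc]

theorem commute_turn (hs : IsBraidSeq m s) {i l : ℕ} (hi : i ≤ m) (hl : l < m)
    (h : i < l ∨ l + 1 < i) : Commute (turn m s i) (s l) := by
  obtain h | h := h
  · obtain ⟨l, rfl⟩ : ∃ k, l = k + 1 := ⟨l - 1, by omega⟩
    have hc : Commute (s (l + 1)) (upProd s i) :=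
      commute_upProd fun j hj => hs.commute (by omega) (by omega) (by omega)
    exact (hc.symm.inv_left.mul_left (hs.commute_turn_zero hl)).mul_left hc.symm
  · have h₁ := hs.upProd_mul h hi
    have h₂ := (hs.commute_turn_zero (i := l) (by omega)).eq
    have h₃ : (upProd s i)⁻¹ * s (l + 1) = s l * (upProd s i)⁻¹ := by
      rw [inv_mul_eq_iff_eq_mul, ← mul_assoc, h₁, mul_inv_cancel_right]
    rw [Commute, SemiconjBy, turn, mul_assoc, h₁, ← mul_assoc, mul_assoc _ _ (s (l + 1)), h₂,
      ← mul_assoc, h₃]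
    simp only [mul_assoc]

theorem commute_turn_mul_turn (hs : IsBraidSeq m s) {k : ℕ} : ∀ i, i + 1 + k = m →
    Commute (turn m s i * turn m s (i + 1)) (s i) := by
  induction k with
  | zero =>
    rintro i rfl
    have h : turn (i + 1) s i = s i ^ 2 * (downProd s i * upProd s i) := by
      rw [eq_mul_inv_of_mul_eq (turn_mul (m := i + 1) s i), turn_self, downProd_succ,
        upProd_succ]
      simp only [sq, mul_assoc, mul_inv_cancel, mul_one]
    rw [h, turn_self, mul_assoc]
    refine ((Commute.refl (s i)).pow_left 2).mul_left ?_
    obtain _ | i := i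
    · simp [downProd, upProd]
    rw [← inv_mul_eq_of_eq_mul (hs.fullTwist_succ (k := i) (by omega)),
      ← inv_mul_eq_of_eq_mul (hs.fullTwist_succ (k := i + 1) (by omega))]
    rw [mul_assoc, mul_inv_cancel_left]
    refine Commute.mul_left ?_ (hs.commute_fullTwist_of_le (by omega) le_rfl)
    exact ((commute_upProd fun j hj => hs.commute (by omega) (by omega)
      (by omega)).pow_right _).symm.inv_left
  | succ k ih =>
    intro i hi
    have h := ih (i + 1) (by omega)
    set g := s (i + 1) * s i with hg
    have hb := hs.braid i (by omega)
    have h₁ : g * s (i + 1) * g⁻¹ = s i := by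
      rw [hg, ← hb]; group
    have hc := (hs.commute_turn (i := i + 2) (l := i) (by omega) (by omega) (by omega)).eq
    have hc' := (hs.commute_turn (i := i) (l := i + 1) (by omega) (by omega) (by omega)).eq
    have t₀ := turn_mul (m := m) s i
    have t₁ := turn_mul (m := m) s (i + 1)
    have h₂ : g * turn m s (i + 2) * g⁻¹ = turn m s (i + 1) := by
      rw [mul_inv_eq_iff_eq_mul, hg, mul_assoc, ← hc, ← mul_assoc, ← t₁, mul_assoc]
    have h₃ : g * turn m s (i + 1) * g⁻¹ = turn m s i := by
      rw [mul_inv_eq_iff_eq_mul, hg, mul_assoc, ← t₀, ← mul_assoc, ← hc', mul_assoc]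
    have := (SemiconjBy.conj_iff (a := turn m s (i + 1) * turn m s (i + 2)) (x := s (i + 1))
      (y := s (i + 1)) (b := g)).2 h
    rw [← conj_mul, h₁, h₂, h₃] at this
    exact this

end IsBraidSeq

/-! ### Braid monoids and braid groups -/

/-- A family indexed by `Fin m`, extended by `1` to a sequence. -/
def finSeq {M : Type*} [One M] {m : ℕ} (f : Fin m → M) (i : ℕ) : M :=
  if h : i < m then f ⟨i, h⟩ else 1

theorem finSeq_of_lt {M : Type*} [One M] {m : ℕ} (f : Fin m → M) {i : ℕ} (h : i < m) :
    finSeq f i = f ⟨i, h⟩ := dif_pos h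

@[simp] theorem finSeq_val {M : Type*} [One M] {m : ℕ} (f : Fin m → M) (i : Fin m) :
    finSeq f i = f i := dif_pos i.2

theorem isBraidSeq_of_braidRels_subset {m : ℕ} {rels : Set (FreeGroup (Fin m))}
    (h : braidRels m ⊆ rels) :
    IsBraidSeq m (finSeq fun i => (PresentedGroup.of i : PresentedGroup rels)) where
  braid i hi := by
    rw [finSeq_of_lt _ hi, finSeq_of_lt _ (i.lt_succ_self.trans hi)]
    refine mul_inv_eq_one.1 (PresentedGroup.one_of_mem (rels := rels) (h ?_))
    exact ⟨⟨i, by omega⟩, ⟨i + 1, hi⟩, .inl ⟨rfl, rfl⟩⟩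
  comm i j hij hj := by
    rw [finSeq_of_lt _ hj, finSeq_of_lt _ (show i < m by omega)]
    refine mul_inv_eq_one.1 (PresentedGroup.one_of_mem (rels := rels) (h ?_))
    exact ⟨⟨i, by omega⟩, ⟨j, hj⟩, .inr ⟨hij, rfl⟩⟩

theorem IsBraidSeq.lift_eq_one {G : Type*} [Group G] {m : ℕ} {s : ℕ → G} (hs : IsBraidSeq m s)
    {r : FreeGroup (Fin m)} (hr : r ∈ braidRels m) :
    FreeGroup.lift (fun i : Fin m => s i) r = 1 := by
  obtain ⟨i, j, ⟨h, rfl⟩ | ⟨h, rfl⟩⟩ := hr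
  · have := hs.braid i (h ▸ j.2)
    simp only [map_mul, map_inv, FreeGroup.lift_apply_of, mul_inv_eq_one]
    rwa [h] at this
  · simpa only [map_mul, map_inv, FreeGroup.lift_apply_of, mul_inv_eq_one] using
      hs.comm i j h j.2

theorem PresentedGroup.induction_of {α : Type*} {rels : Set (FreeGroup α)}
    {p : Subgroup (PresentedGroup rels)} (h : ∀ a, PresentedGroup.of a ∈ p)
    (x : PresentedGroup rels) : x ∈ p := by
  have : (⊤ : Subgroup (PresentedGroup rels)) ≤ p := by
    rw [← PresentedGroup.closure_range_of, Subgroup.closure_le]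
    rintro _ ⟨a, rfl⟩
    exact h a
  exact this trivial

/-- The positive braid monoid with `m` generators. -/
abbrev BraidMonoid (m : ℕ) : Type :=
  ArtinMonoid fun i j : Fin m => (i : ℕ) + 1 = j ∨ (j : ℕ) + 1 = i

namespace BraidMonoid

open ArtinMonoid

variable {m : ℕ}

/-- The generators of the braid monoid. -/
def seq (m : ℕ) : ℕ → BraidMonoid m := finSeq gen

theorem isBraidSeq : IsBraidSeq m (seq m) where
  braid i hi := by
    rw [seq, finSeq_of_lt _ hi, finSeq_of_lt _ (i.lt_succ_self.trans hi)]
    exact gen_braid (.inl rfl)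
  comm i j hij hj := by
    rw [seq, finSeq_of_lt _ hj, finSeq_of_lt _ (show i < m by omega)]
    exact gen_comm (by simp only; omega)

theorem mul_left_cancel {x y z : BraidMonoid m} (h : x * y = x * z) : y = z :=
  mul_left_cancel_of_triangleFree (fun _ _ h => h.symm) (by omega) h

/-- The full twist. -/
def twist (m : ℕ) : BraidMonoid m := upProd (seq m) m ^ (m + 1)

theorem commute_twist (x : BraidMonoid m) : Commute (twist m) x := by
  induction x using ArtinMonoid.induction with
  | one => exact Commute.one_right _
  | gen_mul a x ih =>
    refine Commute.mul_right ?_ ih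
    have := isBraidSeq.commute_fullTwist a.2
    rwa [seq, finSeq_val] at this

theorem exists_gen_mul_eq_twist (a : Fin m) :
    ∃ y : BraidMonoid m, gen a * y = twist m ∧ y * gen a = twist m := by
  obtain ⟨y, hy⟩ := isBraidSeq.dvd_fullTwist a.2
  rw [seq, finSeq_val] at hy
  refine ⟨y, hy.symm, mul_left_cancel (x := gen a) ?_⟩
  rw [← mul_assoc, ← hy]
  exact commute_twist _

noncomputable instance : OreLocalization.OreSet (Submonoid.powers (twist m)) where
  ore_right_cancel x y s h := by
    refine ⟨s, ?_⟩
    obtain ⟨_, k, rfl⟩ := s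
    rwa [((commute_twist x).pow_left k).eq, ((commute_twist y).pow_left k).eq]
  oreNum x _ := x
  oreDenom _ s := s
  ore_eq x s := by
    obtain ⟨_, k, rfl⟩ := s
    exact (commute_twist x).pow_left k

/-- The group of fractions of the braid monoid, as a monoid. -/
abbrev Fractions (m : ℕ) : Type := OreLocalization (Submonoid.powers (twist m)) (BraidMonoid m)

theorem numeratorHom_injective :
    Function.Injective (OreLocalization.numeratorHom : BraidMonoid m →* Fractions m) := by
  intro x y h
  rw [OreLocalization.numeratorHom_apply, OreLocalization.numeratorHom_apply,
    OreLocalization.oreDiv_eq_iff] at h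
  obtain ⟨u, v, h₁, h₂⟩ := h
  simp only [Submonoid.smul_def, OneMemClass.coe_one, mul_one, smul_eq_mul] at h₁ h₂
  rw [← h₂] at h₁
  exact (mul_left_cancel h₁).symm

theorem isUnit_numeratorHom_gen (a : Fin m) :
    IsUnit (OreLocalization.numeratorHom (gen a : BraidMonoid m) : Fractions m) := by
  obtain ⟨y, h₁, h₂⟩ := exists_gen_mul_eq_twist a
  have hz : IsUnit (OreLocalization.numeratorHom (twist m) : Fractions m) :=
    OreLocalization.numerator_isUnit ⟨twist m, Submonoid.mem_powers _⟩
  have hc : Commute (gen a) y := h₁.trans h₂.symm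
  have hz' : IsUnit (OreLocalization.numeratorHom (gen a) * OreLocalization.numeratorHom y :
      Fractions m) := by
    rwa [← map_mul, h₁]
  exact ((hc.map OreLocalization.numeratorHom).isUnit_mul_iff.1 hz').1

/-- The generators as units of the monoid of fractions. -/
noncomputable def fracSeq (m : ℕ) : ℕ → (Fractions m)ˣ :=
  finSeq fun a => (isUnit_numeratorHom_gen a).unit

theorem coe_fracSeq (i : ℕ) :
    (fracSeq m i : Fractions m) = OreLocalization.numeratorHom (seq m i) := by
  by_cases h : i < m
  · rw [fracSeq, finSeq_of_lt _ h, seq, finSeq_of_lt _ h]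
    rfl
  · rw [fracSeq, finSeq, dif_neg h, seq, finSeq, dif_neg h, map_one, Units.val_one]

theorem isBraidSeq_fracSeq : IsBraidSeq m (fracSeq m) where
  braid i hi := by
    apply Units.ext
    simpa only [Units.val_mul, coe_fracSeq] using
      (isBraidSeq.map OreLocalization.numeratorHom).braid i hi
  comm i j hij hj := by
    apply Units.ext
    simpa only [Units.val_mul, coe_fracSeq] using
      (isBraidSeq.map OreLocalization.numeratorHom).comm i j hij hj

end BraidMonoid

/-- The generators of the braid group. -/
def braidSeq (m : ℕ) : ℕ → PresentedGroup (braidRels m) := finSeq fun i => PresentedGroup.of i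

theorem isBraidSeq_braidSeq (m : ℕ) : IsBraidSeq m (braidSeq m) :=
  isBraidSeq_of_braidRels_subset subset_rfl

/-- The full twist in the braid group. -/
def braidTwist (m : ℕ) : PresentedGroup (braidRels m) := upProd (braidSeq m) m ^ (m + 1)

/-- The homomorphism from the braid group given by a sequence satisfying the braid relations. -/
def braidLift {G : Type*} [Group G] {m : ℕ} {s : ℕ → G} (hs : IsBraidSeq m s) :
    PresentedGroup (braidRels m) →* G :=
  PresentedGroup.toGroup fun _ hr => hs.lift_eq_one hr

theorem braidLift_of {G : Type*} [Group G] {m : ℕ} {s : ℕ → G} (hs : IsBraidSeq m s)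
    (i : Fin m) : braidLift hs (PresentedGroup.of i) = s i :=
  PresentedGroup.toGroup.of _

theorem braidLift_braidSeq {G : Type*} [Group G] {m : ℕ} {s : ℕ → G} (hs : IsBraidSeq m s)
    {i : ℕ} (hi : i < m) : braidLift hs (braidSeq m i) = s i := by
  rw [braidSeq, finSeq_of_lt _ hi, braidLift_of]

theorem braidLift_upProd {G : Type*} [Group G] {m k : ℕ} {s : ℕ → G} (hs : IsBraidSeq m s)
    (hk : k ≤ m) : braidLift hs (upProd (braidSeq m) k) = upProd s k := by
  rw [map_upProd]
  exact upProd_congr fun i hi => braidLift_braidSeq hs (hi.trans_le hk)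

theorem commute_braidTwist {m : ℕ} (x : PresentedGroup (braidRels m)) :
    Commute (braidTwist m) x := by
  suffices x ∈ Subgroup.centralizer {braidTwist m} from
    (Subgroup.mem_centralizer_singleton_iff.1 this).symm
  refine PresentedGroup.induction_of (fun i => ?_) x
  rw [Subgroup.mem_centralizer_singleton_iff]
  have := (isBraidSeq_braidSeq m).commute_fullTwist i.2
  rw [braidSeq, finSeq_val] at this
  exact this.symm

namespace BraidMonoid

open ArtinMonoid

variable {m : ℕ}

/-- The homomorphism from the braid monoid to the braid group. -/
def toGroup (m : ℕ) : BraidMonoid m →* PresentedGroup (braidRels m) :=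
  lift PresentedGroup.of
    (fun a b h => by
      obtain rfl | hne := eq_or_ne a b
      · rfl
      have := (isBraidSeq_braidSeq m).commute a.2 b.2 (by
        have := Fin.val_ne_of_ne hne
        omega)
      simpa only [braidSeq, finSeq_val] using this.eq)
    (fun a b h => by
      have hb := (isBraidSeq_braidSeq m).braid
      obtain h | h := h
      · have := hb a (h ▸ b.2)
        rw [h] at this
        simpa only [braidSeq, finSeq_val] using this
      · have := hb b (h ▸ a.2)
        rw [h] at this
        simpa only [braidSeq, finSeq_val] using this.symm)

@[simp] theorem toGroup_gen (a : Fin m) : toGroup m (gen a) = PresentedGroup.of a :=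
  lift_gen _ _ _ a

theorem toGroup_twist : toGroup m (twist m) = braidTwist m := by
  rw [twist, map_pow, map_upProd, braidTwist]
  congr 1
  refine upProd_congr fun i hi => ?_
  rw [seq, finSeq_of_lt _ hi, toGroup_gen, braidSeq, finSeq_of_lt _ hi]

theorem toGroup_injective : Function.Injective (toGroup m) := by
  have key (x : BraidMonoid m) : (braidLift isBraidSeq_fracSeq (toGroup m x) : Fractions m) =
      OreLocalization.numeratorHom x := by
    induction x using ArtinMonoid.induction with
    | one => rw [map_one, map_one, Units.val_one, map_one]
    | gen_mul a x ih =>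
      rw [map_mul, map_mul, Units.val_mul, ih, map_mul, toGroup_gen, braidLift_of, coe_fracSeq,
        seq, finSeq_val]
  intro x y h
  apply numeratorHom_injective
  rw [← key, ← key, h]

theorem exists_toGroup_eq (x : PresentedGroup (braidRels m)) :
    ∃ (X : BraidMonoid m) (a : ℕ), toGroup m X = x * braidTwist m ^ a := by
  have hmul {x y : PresentedGroup (braidRels m)} :
      (∃ (X : BraidMonoid m) (a : ℕ), toGroup m X = x * braidTwist m ^ a) →
      (∃ (X : BraidMonoid m) (a : ℕ), toGroup m X = y * braidTwist m ^ a) →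
      ∃ (X : BraidMonoid m) (a : ℕ), toGroup m X = x * y * braidTwist m ^ a := by
    rintro ⟨X, a, hX⟩ ⟨Y, b, hY⟩
    refine ⟨X * Y, a + b, ?_⟩
    rw [map_mul, hX, hY, pow_add, mul_assoc, ← mul_assoc (_ ^ a),
      ((commute_braidTwist y).pow_left a).eq]
    simp only [mul_assoc]
  have hx : x ∈ Subgroup.closure (Set.range (PresentedGroup.of (rels := braidRels m))) := by
    rw [PresentedGroup.closure_range_of]; trivial
  induction hx using Subgroup.closure_induction'' with
  | mem x h =>
    obtain ⟨a, rfl⟩ := h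
    exact ⟨gen a, 0, by simp⟩
  | inv_mem x h =>
    obtain ⟨a, rfl⟩ := h
    obtain ⟨y, h, -⟩ := exists_gen_mul_eq_twist a
    refine ⟨y, 1, ?_⟩
    rw [pow_one, ← toGroup_twist, ← h, map_mul, toGroup_gen, inv_mul_cancel_left]
  | one => exact ⟨1, 0, by simp⟩
  | mul x y _ _ ihx ihy => exact hmul ihx ihy

/-- An element of the braid monoid with a power equal to that power of a power of the full
twist is itself a power of the full twist. -/
theorem eq_of_pow_eq {X : BraidMonoid m} {a k : ℕ} (hk : 0 < k)
    (h : X ^ k = (twist m ^ a) ^ k) : X = twist m ^ a := by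
  set w := twist m ^ a with hw
  have hc (Y : BraidMonoid m) : Commute w Y := (commute_twist Y).pow_left a
  have hwX (i : ℕ) : w * (w ^ (k - (i + 1)) * X ^ (i + 1)) = w ^ (k - (i + 1) + 1) * X ^ (i + 1) := by
    rw [← mul_assoc, ← pow_succ']
  let f : ℕ → BraidMonoid m := fun i => w ^ (k - i) * X ^ i
  have hf (i : ℕ) (hi : i < k) : X * f i = w * f (i + 1) := by
    simp only [f]
    rw [hwX, show k - (i + 1) + 1 = k - i by omega, ← mul_assoc,
      ← ((hc X).pow_left (k - i)).eq, mul_assoc, ← pow_succ']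
  have hf₀ : f 0 = f k := by simp [f, h]
  obtain ⟨L, hL₁, hL₂⟩ := exists_lcm_family (fun _ _ h => h.symm) (by omega) f (w ^ k * X ^ k) k
    fun i hi => by
      refine ⟨w ^ i * X ^ (k - i), ?_⟩
      simp only [f]
      rw [mul_assoc, ← mul_assoc (X ^ i), ← (((hc X).pow_left i).pow_right i).eq, mul_assoc,
        ← mul_assoc (w ^ (k - i)), ← pow_add, ← pow_add, Nat.sub_add_cancel hi.le,
        Nat.add_sub_cancel' hi.le]
  have hdvd (i : ℕ) (hi : i < k) : w * f (i + 1) ∣ X * L :=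
    hf i hi ▸ mul_dvd_mul_left X (hL₁ i hi)
  obtain ⟨C, hC⟩ := (dvd_mul_right w (f 1)).trans (hdvd 0 hk)
  have hfC (i : ℕ) (hi : i < k) : f (i + 1) ∣ C := by
    obtain ⟨D, hD⟩ := hdvd i hi
    rw [hC, mul_assoc] at hD
    exact ⟨D, mul_left_cancel hD⟩
  obtain ⟨D, rfl⟩ := hL₂ C fun i hi => by
    obtain _ | i := i
    · have := hfC (k - 1) (by omega)
      rwa [show k - 1 + 1 = k by omega, ← hf₀] at this
    · exact hfC i (by omega)
  have hlen : X.length = w.length := by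
    have := congrArg ArtinMonoid.length h
    simp only [length_pow] at this
    exact Nat.eq_of_mul_eq_mul_left hk this
  have hD : D = 1 := by
    apply eq_one_of_length_eq_zero
    have := congrArg ArtinMonoid.length hC
    simp only [length_mul] at this
    omega
  rw [hD, mul_one] at hC
  apply toGroup_injective
  have := congrArg (toGroup m) hC
  rw [map_mul, map_mul] at this
  exact mul_right_cancel this

end BraidMonoid

/-- Braid groups are torsion-free. -/
theorem eq_one_of_pow_eq_one_braid {m k : ℕ} {x : PresentedGroup (braidRels m)} (hk : 0 < k)
    (h : x ^ k = 1) : x = 1 := by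
  obtain ⟨X, a, hX⟩ := BraidMonoid.exists_toGroup_eq x
  have hXa : X = BraidMonoid.twist m ^ a := by
    refine BraidMonoid.eq_of_pow_eq hk (BraidMonoid.toGroup_injective ?_)
    rw [map_pow, hX, ((commute_braidTwist x).symm.pow_right a).mul_pow, h, one_mul, map_pow,
      map_pow, BraidMonoid.toGroup_twist]
  rw [hXa, map_pow, BraidMonoid.toGroup_twist] at hX
  exact (mul_eq_right.1 hX.symm)

/-! ### Monomial matrices -/

/-- A permutation of `ℕ` together with a coefficient for each point of `ι`, on which
permutations of `ℕ` act. -/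
@[ext]
structure Monomial (ι H : Type*) where
  /-- The underlying permutation. -/
  perm : Equiv.Perm ℕ
  /-- The coefficients. -/
  coeff : ι → H

namespace Monomial

variable {ι H : Type*} [MulAction (Equiv.Perm ℕ) ι] [Group H]

instance : Group (Monomial ι H) where
  mul g h := ⟨g.perm * h.perm, fun i => g.coeff (h.perm • i) * h.coeff i⟩
  one := ⟨1, fun _ => 1⟩
  inv g := ⟨g.perm⁻¹, fun i => (g.coeff (g.perm⁻¹ • i))⁻¹⟩
  mul_assoc f g h := Monomial.ext (mul_assoc _ _ _) <| funext fun i => by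
    change f.coeff (g.perm • h.perm • i) * g.coeff (h.perm • i) * h.coeff i =
      f.coeff ((g.perm * h.perm) • i) * (g.coeff (h.perm • i) * h.coeff i)
    rw [mul_smul, mul_assoc]
  one_mul g := Monomial.ext (one_mul _) <| funext fun i => one_mul _
  mul_one g := Monomial.ext (mul_one _) <| funext fun i => by
    change g.coeff ((1 : Equiv.Perm ℕ) • i) * 1 = g.coeff i
    rw [one_smul, mul_one]
  inv_mul_cancel g := Monomial.ext (inv_mul_cancel _) <| funext fun i => by
    change (g.coeff (g.perm⁻¹ • g.perm • i))⁻¹ * g.coeff i = 1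
    rw [inv_smul_smul, inv_mul_cancel]

@[simp] theorem perm_mul (g h : Monomial ι H) : (g * h).perm = g.perm * h.perm := rfl

@[simp] theorem perm_one : (1 : Monomial ι H).perm = 1 := rfl

theorem coeff_mul (g h : Monomial ι H) (i : ι) :
    (g * h).coeff i = g.coeff (h.perm • i) * h.coeff i := rfl

@[simp] theorem coeff_one (i : ι) : (1 : Monomial ι H).coeff i = 1 := rfl

/-- The underlying permutation, as a homomorphism. -/
@[simps]
def permHom (ι H : Type*) [MulAction (Equiv.Perm ℕ) ι] [Group H] :
    Monomial ι H →* Equiv.Perm ℕ where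
  toFun := perm
  map_one' := rfl
  map_mul' _ _ := rfl

/-- The coefficient of a point, as a homomorphism on its stabilizer. -/
@[simps]
def coeffHom (i : ι) :
    (MulAction.stabilizer (Equiv.Perm ℕ) i).comap (permHom ι H) →* H where
  toFun g := g.1.coeff i
  map_one' := rfl
  map_mul' g h := by
    change g.1.coeff (h.1.perm • i) * h.1.coeff i = _
    rw [show h.1.perm • i = i from h.2]

theorem coeff_pow {g : Monomial ι H} {i : ι} (h : g.perm • i = i) (k : ℕ) :
    (g ^ k).coeff i = g.coeff i ^ k :=
  map_pow (coeffHom i) (⟨g, h⟩ : (MulAction.stabilizer (Equiv.Perm ℕ) i).comap (permHom ι H)) k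

theorem coeff_zpow {g : Monomial ι H} {i : ι} (h : g.perm • i = i) (k : ℤ) :
    (g ^ k).coeff i = g.coeff i ^ k :=
  map_zpow (coeffHom i) (⟨g, h⟩ : (MulAction.stabilizer (Equiv.Perm ℕ) i).comap (permHom ι H)) k

end Monomial

/-! ### Permutations -/

/-- The sequence of adjacent transpositions. -/
def swapSeq (j : ℕ) : Equiv.Perm ℕ := Equiv.swap j (j + 1)

theorem swapSeq_apply (j i : ℕ) :
    swapSeq j i = if i = j then j + 1 else if i = j + 1 then j else i :=
  Equiv.swap_apply_def _ _ _

theorem isBraidSeq_swapSeq (m : ℕ) : IsBraidSeq m swapSeq where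
  braid i _ := by
    ext a
    simp only [Equiv.Perm.mul_apply, swapSeq_apply]
    grind
  comm i j h _ := by
    ext a
    simp only [Equiv.Perm.mul_apply, swapSeq_apply]
    grind

theorem upProd_swapSeq_apply (k i : ℕ) :
    upProd swapSeq k i = if i < k then i + 1 else if i = k then 0 else i := by
  induction k generalizing i with
  | zero => simp +contextual
  | succ k ih =>
    rw [upProd_succ, Equiv.Perm.mul_apply, ih, swapSeq_apply]
    grind

theorem downProd_swapSeq_apply (k i : ℕ) :
    downProd swapSeq k i = if i = 0 then k else if i ≤ k then i - 1 else i := by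
  induction k generalizing i with
  | zero => simp +contextual
  | succ k ih =>
    rw [downProd_succ, Equiv.Perm.mul_apply, ih, swapSeq_apply]
    grind

theorem upProd_swapSeq_pow_apply {k t i : ℕ} (ht : t ≤ k + 1) (hi : i ≤ k) :
    (upProd swapSeq k ^ t) i = if i + t ≤ k then i + t else i + t - (k + 1) := by
  induction t generalizing i with
  | zero => simp [hi]
  | succ t ih =>
    rw [pow_succ, Equiv.Perm.mul_apply, upProd_swapSeq_apply]
    split_ifs <;> first | omega | (rw [ih (by omega) (by omega)]; split_ifs <;> omega)

theorem upProd_swapSeq_pow (k : ℕ) : upProd swapSeq k ^ (k + 1) = 1 := by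
  ext i
  rw [Equiv.Perm.one_apply]
  by_cases hi : i ≤ k
  · rw [upProd_swapSeq_pow_apply le_rfl hi]
    split_ifs <;> omega
  · have h : upProd swapSeq k i = i := by rw [upProd_swapSeq_apply]; split_ifs <;> omega
    exact Function.IsFixedPt.perm_pow h _

theorem upProd_mul_downProd_swapSeq (k : ℕ) : upProd swapSeq k * downProd swapSeq k = 1 := by
  ext i
  rw [Equiv.Perm.mul_apply, downProd_swapSeq_apply, upProd_swapSeq_apply, Equiv.Perm.one_apply]
  grind

/-! ### Linking numbers -/

/-- The generators of the braid group, with a permutation and half-linking numbers. -/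
def linkingSeq (j : ℕ) : Monomial (ℕ × ℕ) (Multiplicative ℤ) where
  perm := swapSeq j
  coeff p := if p = (j, j + 1) then Multiplicative.ofAdd 1 else 1

theorem isBraidSeq_linkingSeq (m : ℕ) : IsBraidSeq m linkingSeq where
  braid i hi := by
    ext p
    · exact DFunLike.congr_fun ((isBraidSeq_swapSeq m).braid i hi) _
    · obtain ⟨a, b⟩ := p
      simp only [Monomial.coeff_mul, linkingSeq, Prod.smul_mk, Equiv.Perm.smul_def, swapSeq_apply,
        Prod.mk.injEq]
      grind
  comm i j h hj := by
    ext p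
    · exact DFunLike.congr_fun ((isBraidSeq_swapSeq m).comm i j h hj) _
    · obtain ⟨a, b⟩ := p
      simp only [Monomial.coeff_mul, linkingSeq, Prod.smul_mk, Equiv.Perm.smul_def, swapSeq_apply,
        Prod.mk.injEq]
      grind (splits := 20)

theorem perm_upProd_linkingSeq (k : ℕ) : (upProd linkingSeq k).perm = upProd swapSeq k :=
  map_upProd (Monomial.permHom _ _) _ _

theorem coeff_upProd_linkingSeq (k i j : ℕ) :
    (upProd linkingSeq k).coeff (i, j) = if j = k ∧ i < k then Multiplicative.ofAdd 1 else 1 := by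
  induction k generalizing i j with
  | zero => simp
  | succ k ih =>
    rw [upProd_succ, Monomial.coeff_mul]
    simp only [linkingSeq, Prod.smul_mk, Equiv.Perm.smul_def, swapSeq_apply, ih, Prod.mk.injEq]
    grind

theorem coeff_upProd_linkingSeq_pow {k t i j : ℕ} (ht : t ≤ k + 1) (hij : i ≠ j) (hi : i ≤ k)
    (hj : j ≤ k) : (upProd linkingSeq k ^ t).coeff (i, j) =
      if j + t ≤ k then 1 else Multiplicative.ofAdd 1 := by
  induction t generalizing i j with
  | zero => simp [hj]
  | succ t ih =>
    rw [pow_succ, Monomial.coeff_mul, coeff_upProd_linkingSeq, perm_upProd_linkingSeq,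
      Prod.smul_mk, Equiv.Perm.smul_def, Equiv.Perm.smul_def, ih (by omega)
        ((upProd swapSeq k).injective.ne hij)]
    all_goals simp only [upProd_swapSeq_apply]
    all_goals grind

theorem perm_braidLift_linkingSeq {m : ℕ} (x : PresentedGroup (braidRels m)) :
    (braidLift (isBraidSeq_linkingSeq m) x).perm = braidLift (isBraidSeq_swapSeq m) x := by
  have : (Monomial.permHom _ _).comp (braidLift (isBraidSeq_linkingSeq m)) =
      braidLift (isBraidSeq_swapSeq m) := by
    ext i : 1
    simp only [MonoidHom.comp_apply, braidLift_of]
    rfl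
  exact DFunLike.congr_fun this x

/-- A braid with a power equal to a power of the full twist is a power of the full twist, if
its permutation has at least two fixed points. -/
theorem mem_zpowers_braidTwist {m k a b : ℕ} {x : PresentedGroup (braidRels m)} (hk : 0 < k)
    (hx : x ^ k ∈ Subgroup.zpowers (braidTwist m)) (hab : a ≠ b) (ha : a ≤ m) (hb : b ≤ m)
    (hxa : braidLift (isBraidSeq_swapSeq m) x a = a)
    (hxb : braidLift (isBraidSeq_swapSeq m) x b = b) : x ∈ Subgroup.zpowers (braidTwist m) := by
  obtain ⟨e, he⟩ := Subgroup.mem_zpowers_iff.1 hx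
  set f := braidLift (isBraidSeq_linkingSeq m)
  have hfx : (f x).perm • (a, b) = (a, b) := by
    rw [perm_braidLift_linkingSeq, Prod.smul_mk, Equiv.Perm.smul_def, Equiv.Perm.smul_def, hxa, hxb]
  have hfz : f (braidTwist m) = upProd linkingSeq m ^ (m + 1) := by
    rw [braidTwist, map_pow, braidLift_upProd _ le_rfl]
  have hz : (f (braidTwist m)).perm • (a, b) = (a, b) := by
    rw [hfz, ← Monomial.permHom_apply, map_pow, Monomial.permHom_apply, perm_upProd_linkingSeq,
      upProd_swapSeq_pow, one_smul]
  have hz' : (f (braidTwist m)).coeff (a, b) = Multiplicative.ofAdd 1 := by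
    rw [hfz, coeff_upProd_linkingSeq_pow le_rfl hab ha hb, if_neg (by omega)]
  have h := congrArg (fun y => (f y).coeff (a, b)) he
  simp only [map_pow, map_zpow, Monomial.coeff_pow hfx, Monomial.coeff_zpow hz, hz'] at h
  obtain ⟨l, hl⟩ : ∃ l : ℤ, e = l * k := by
    refine ⟨((f x).coeff (a, b)).toAdd, ?_⟩
    have := congrArg Multiplicative.toAdd h
    simpa [mul_comm] using this
  have hc : Commute x (braidTwist m ^ (-l)) := (commute_braidTwist x).symm.zpow_right _
  refine ⟨l, ?_⟩
  have := eq_one_of_pow_eq_one_braid (x := x * braidTwist m ^ (-l)) hk (by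
    rw [hc.mul_pow, ← he, ← zpow_natCast, ← zpow_mul, ← zpow_add, hl]
    simp)
  rw [zpow_neg, mul_inv_eq_one] at this
  exact this.symm

/-! ### The degree -/

/-- The exponent sum of a braid. -/
def braidDegree (m : ℕ) : PresentedGroup (braidRels m) →* Multiplicative ℤ :=
  braidLift (m := m) (s := fun _ => Multiplicative.ofAdd 1) ⟨fun _ _ => rfl, fun _ _ _ _ => rfl⟩

theorem braidDegree_braidTwist (m : ℕ) :
    braidDegree m (braidTwist m) = Multiplicative.ofAdd ((m * (m + 1) : ℕ) : ℤ) := by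
  have h (k : ℕ) : upProd (fun _ => Multiplicative.ofAdd (1 : ℤ)) k =
      Multiplicative.ofAdd (1 : ℤ) ^ k := by
    induction k with
    | zero => simp
    | succ k ih => rw [upProd_succ, ih, pow_succ]
  rw [braidTwist, map_pow, braidDegree, braidLift_upProd _ le_rfl, h, ← pow_mul, ← ofAdd_nsmul]
  simp

/-- A braid that is inverted by another one modulo the full twist, and of finite order modulo
the full twist, has order at most two modulo the full twist. -/
theorem sq_mem_zpowers_braidTwist {m k : ℕ} {x y : PresentedGroup (braidRels m)} (hm : 0 < m)
    (hk : 0 < k) (hx : x ^ k ∈ Subgroup.zpowers (braidTwist m))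
    (hxy : y * x * y⁻¹ * x ∈ Subgroup.zpowers (braidTwist m)) :
    x ^ 2 ∈ Subgroup.zpowers (braidTwist m) := by
  obtain ⟨e, he⟩ := Subgroup.mem_zpowers_iff.1 hx
  obtain ⟨a, ha⟩ := Subgroup.mem_zpowers_iff.1 hxy
  have he' := congrArg (fun w => (braidDegree m w).toAdd) he
  have ha' := congrArg (fun w => (braidDegree m w).toAdd) ha
  simp only [map_zpow, map_pow, map_mul, map_inv, braidDegree_braidTwist, toAdd_zpow, toAdd_pow,
    toAdd_mul, toAdd_inv, toAdd_ofAdd, smul_eq_mul] at he' ha'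
  set d := (braidDegree m x).toAdd
  set N : ℤ := ((m * (m + 1) : ℕ) : ℤ)
  have hN : N ≠ 0 := by positivity
  have h : 2 * e = a * k := by
    apply mul_right_cancel₀ hN
    simp only [nsmul_eq_mul] at he'
    linear_combination 2 * he' - k * ha'
  have hc : Commute (x ^ 2) (braidTwist m ^ (-a)) :=
    ((commute_braidTwist x).symm.zpow_right _).pow_left 2
  have := eq_one_of_pow_eq_one_braid (x := x ^ 2 * braidTwist m ^ (-a)) hk (by
    rw [hc.mul_pow, ← pow_mul, mul_comm, pow_mul, ← he, ← zpow_natCast, ← zpow_natCast, ← zpow_mul,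
      ← zpow_mul, ← zpow_add, show e * (2 : ℕ) + -a * k = 0 by push_cast; linarith, zpow_zero])
  rw [zpow_neg, mul_inv_eq_one] at this
  exact ⟨a, this.symm⟩

/-! ### Induced monomial representations -/

namespace IsBraidSeq

section

variable {G : Type*} [Group G] {m : ℕ} {s : ℕ → G}

theorem downProd_pow (hs : IsBraidSeq m s) {k : ℕ} (hk : k ≤ m) :
    downProd s k ^ (k + 1) = upProd s k ^ (k + 1) := by
  have ho : IsBraidSeq m fun i => MulOpposite.op (s i) :=
    ⟨fun i hi => by simpa [← MulOpposite.op_mul, mul_assoc] using hs.braid i hi,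
      fun i j hij hj => by simpa [← MulOpposite.op_mul] using (hs.comm i j hij hj).symm⟩
  have hup (k : ℕ) : upProd (fun i => MulOpposite.op (s i)) k = MulOpposite.op (downProd s k) := by
    induction k with
    | zero => rfl
    | succ k ih => rw [upProd_succ, ih, downProd_succ, MulOpposite.op_mul]
  have hdown (k : ℕ) :
      downProd (fun i => MulOpposite.op (s i)) k = MulOpposite.op (upProd s k) := by
    induction k with
    | zero => rfl
    | succ k ih => rw [downProd_succ, ih, upProd_succ, MulOpposite.op_mul]
  induction k with
  | zero => rfl
  | succ k ih =>
    have h := ho.fullTwist_succ (k := k) (by omega)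
    rw [hup, hup, hdown, ← MulOpposite.op_pow, ← MulOpposite.op_pow, ← MulOpposite.op_mul,
      ← MulOpposite.op_mul, MulOpposite.op_inj] at h
    rw [h, ih (by omega), hs.fullTwist_succ (by omega)]
    exact (commute_upProd fun i hi => hs.commute_down_mul_up (by omega) hk).pow_right _

/-- The coefficients of the generators in the monomial representation of the braid group on
`m + 2` strands induced from the stabilizer of a point. -/
def pointCoeff (m : ℕ) (s : ℕ → G) (j i : ℕ) : G :=
  if i < j then s (j - 1) else if i = j then (turn m s j)⁻¹ else if i = j + 1 then 1
  else if i ≤ m + 1 then s j else 1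

theorem pointCoeff_of_lt {i j : ℕ} (h : i < j) : pointCoeff m s j i = s (j - 1) := if_pos h

theorem pointCoeff_self {j : ℕ} : pointCoeff m s j j = (turn m s j)⁻¹ := by
  simp [pointCoeff]

theorem pointCoeff_succ {j : ℕ} : pointCoeff m s j (j + 1) = 1 := by
  simp [pointCoeff]

theorem pointCoeff_of_gt {i j : ℕ} (h : j + 1 < i) (hi : i ≤ m + 1) : pointCoeff m s j i = s j := by
  rw [pointCoeff, if_neg (by omega), if_neg (by omega), if_neg (by omega), if_pos hi]

theorem pointCoeff_eq_one {i j : ℕ} (hj : j < i) (hi : m + 1 < i) : pointCoeff m s j i = 1 := by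
  simp only [pointCoeff]
  split_ifs <;> first | rfl | omega

/-- The generators in the induced monomial representation. -/
def pointSeq (m : ℕ) (s : ℕ → G) (j : ℕ) : Monomial ℕ G where
  perm := swapSeq j
  coeff := pointCoeff m s j

theorem swapSeq_self (j : ℕ) : swapSeq j j = j + 1 := Equiv.swap_apply_left _ _

theorem swapSeq_succ (j : ℕ) : swapSeq j (j + 1) = j := Equiv.swap_apply_right _ _

theorem swapSeq_of_ne {i j : ℕ} (h : i ≠ j) (h' : i ≠ j + 1) : swapSeq j i = i :=
  Equiv.swap_apply_of_ne_of_ne h h'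

theorem isBraidSeq_pointSeq (hs : IsBraidSeq m s) : IsBraidSeq (m + 1) (pointSeq m s) where
  braid j hj := by
    ext i
    · exact DFunLike.congr_fun ((isBraidSeq_swapSeq (m + 1)).braid j hj) _
    simp only [Monomial.coeff_mul, pointSeq, Equiv.Perm.smul_def]
    obtain h | rfl | rfl | rfl | h : i < j ∨ i = j ∨ i = j + 1 ∨ i = j + 1 + 1 ∨ j + 1 + 1 < i := by
      omega
    · obtain ⟨j, rfl⟩ : ∃ l, j = l + 1 := ⟨j - 1, by omega⟩
      rw [swapSeq_of_ne (j := j + 1) (by omega) (by omega),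
        swapSeq_of_ne (j := j + 1 + 1) (by omega) (by omega),
        swapSeq_of_ne (j := j + 1) (by omega) (by omega), pointCoeff_of_lt h,
        pointCoeff_of_lt (by omega)]
      exact hs.braid j (by omega)
    · rw [swapSeq_self, swapSeq_self, swapSeq_of_ne (i := i) (j := i + 1) (by omega) (by omega),
        swapSeq_self, pointCoeff_of_gt (by omega) (by omega), pointCoeff_self, pointCoeff_self,
        pointCoeff_of_lt (by omega), ← mul_inv_rev, Nat.add_sub_cancel, mul_assoc,
        ← mul_inv_rev]
      exact ((hs.commute_turn_mul_turn (k := m - (i + 1)) i (by omega)).inv_left.eq).symm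
    · rw [swapSeq_succ, swapSeq_of_ne (i := j) (j := j + 1) (by omega) (by omega), swapSeq_self,
        swapSeq_of_ne (i := j + 1 + 1) (j := j) (by omega) (by omega), pointCoeff_self,
        pointCoeff_of_lt (by omega), pointCoeff_succ, pointCoeff_succ, pointCoeff_self,
        pointCoeff_of_gt (by omega) (by omega), mul_one, one_mul, Nat.add_sub_cancel,
        inv_mul_eq_iff_eq_mul, ← mul_assoc, turn_mul, mul_inv_cancel_right]
    · rw [swapSeq_of_ne (i := j + 1 + 1) (j := j) (by omega) (by omega), swapSeq_succ,
        swapSeq_succ, pointCoeff_succ, pointCoeff_succ, pointCoeff_of_gt (by omega) (by omega),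
        pointCoeff_of_lt (by omega), one_mul, one_mul, mul_one, mul_one, Nat.add_sub_cancel]
    · rw [swapSeq_of_ne (j := j) (by omega) (by omega),
        swapSeq_of_ne (j := j + 1) (by omega) (by omega),
        swapSeq_of_ne (j := j) (by omega) (by omega)]
      by_cases hi : i ≤ m + 1
      · rw [pointCoeff_of_gt (by omega) hi, pointCoeff_of_gt (by omega) hi]
        exact hs.braid j (by omega)
      · rw [pointCoeff_eq_one (by omega) (by omega), pointCoeff_eq_one (by omega) (by omega)]
  comm j k hjk hk := by
    ext i
    · exact DFunLike.congr_fun ((isBraidSeq_swapSeq (m + 1)).comm j k hjk hk) _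
    simp only [Monomial.coeff_mul, pointSeq, Equiv.Perm.smul_def]
    obtain ⟨k, rfl⟩ : ∃ l, k = l + 1 := ⟨k - 1, by omega⟩
    obtain h | rfl | rfl | h | rfl | rfl | h : i < j ∨ i = j ∨ i = j + 1 ∨
      (j + 1 < i ∧ i < k + 1) ∨ i = k + 1 ∨ i = k + 1 + 1 ∨ k + 1 + 1 < i := by omega
    · obtain ⟨j, rfl⟩ : ∃ l, j = l + 1 := ⟨j - 1, by omega⟩
      rw [swapSeq_of_ne (by omega) (by omega), swapSeq_of_ne (by omega) (by omega),
        pointCoeff_of_lt (by omega), pointCoeff_of_lt (by omega)]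
      exact hs.comm j k (by omega) (by omega)
    · rw [swapSeq_of_ne (by omega) (by omega), swapSeq_self, pointCoeff_self,
        pointCoeff_of_lt (by omega), pointCoeff_of_lt (by omega)]
      exact (hs.commute_turn (by omega) (by omega) (by left; omega)).inv_left.eq
    · rw [swapSeq_of_ne (by omega) (by omega), swapSeq_succ, pointCoeff_succ,
        pointCoeff_of_lt (by omega), pointCoeff_of_lt (by omega), mul_one, one_mul]
    · rw [swapSeq_of_ne (by omega) (by omega), swapSeq_of_ne (by omega) (by omega),
        pointCoeff_of_lt (j := k + 1) (by omega), pointCoeff_of_gt (by omega) (by omega)]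
      exact hs.comm j k (by omega) (by omega)
    · rw [swapSeq_of_ne (j := j) (by omega) (by omega), swapSeq_self, pointCoeff_self,
        pointCoeff_of_gt (by omega) (by omega), pointCoeff_of_gt (by omega) (by omega)]
      exact (hs.commute_turn (by omega) (by omega) (by right; omega)).inv_left.eq.symm
    · rw [swapSeq_of_ne (j := j) (by omega) (by omega), swapSeq_succ, pointCoeff_succ,
        pointCoeff_of_gt (by omega) (by omega), pointCoeff_of_gt (by omega) (by omega), mul_one,
        one_mul]
    · rw [swapSeq_of_ne (by omega) (by omega), swapSeq_of_ne (by omega) (by omega)]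
      by_cases hi : i ≤ m + 1
      · rw [pointCoeff_of_gt (by omega) hi, pointCoeff_of_gt (by omega) hi]
        exact hs.comm j (k + 1) (by omega) (by omega)
      · rw [pointCoeff_eq_one (by omega) (by omega), pointCoeff_eq_one (by omega) (by omega)]

theorem perm_upProd_pointSeq (k : ℕ) : (upProd (pointSeq m s) k).perm = upProd swapSeq k :=
  map_upProd (Monomial.permHom _ _) _ _

theorem perm_downProd_pointSeq (k : ℕ) : (downProd (pointSeq m s) k).perm = downProd swapSeq k :=
  map_downProd (Monomial.permHom _ _) _ _

theorem coeff_upProd_pointSeq_succ (k i : ℕ) : (upProd (pointSeq m s) (k + 1)).coeff i =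
    (upProd (pointSeq m s) k).coeff (swapSeq k i) * pointCoeff m s k i := rfl

theorem coeff_upProd_pointSeq_of_gt {k i : ℕ} (hk : k < i) (hi : i ≤ m + 1) :
    (upProd (pointSeq m s) k).coeff i = upProd s k := by
  induction k with
  | zero => simp
  | succ k ih =>
    rw [coeff_upProd_pointSeq_succ, swapSeq_of_ne (by omega) (by omega), ih (by omega),
      pointCoeff_of_gt hk hi, upProd_succ]

theorem coeff_upProd_pointSeq_self (k : ℕ) : (upProd (pointSeq m s) k).coeff k = 1 := by
  induction k with
  | zero => rfl
  | succ k ih => rw [coeff_upProd_pointSeq_succ, swapSeq_succ, ih, pointCoeff_succ, one_mul]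

theorem coeff_upProd_pointSeq_of_lt {k i : ℕ} (hi : i ≤ k) (hk : k ≤ m) :
    (upProd (pointSeq m s) (k + 1)).coeff i = (downProd s m)⁻¹ * (upProd s m)⁻¹ * upProd s k := by
  induction k, hi using Nat.le_induction with
  | base =>
    rw [coeff_upProd_pointSeq_succ, swapSeq_self, coeff_upProd_pointSeq_of_gt (by omega) (by omega),
      pointCoeff_self, turn]
    group
  | succ k hik ih =>
    rw [coeff_upProd_pointSeq_succ, swapSeq_of_ne (by omega) (by omega), ih (by omega),
      pointCoeff_of_lt (by omega), Nat.add_sub_cancel, upProd_succ, mul_assoc]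

theorem coeff_upProd_pointSeq {i : ℕ} (hi : i ≤ m) :
    (upProd (pointSeq m s) (m + 1)).coeff i = (downProd s m)⁻¹ := by
  rw [coeff_upProd_pointSeq_of_lt hi le_rfl, inv_mul_cancel_right]

theorem coeff_downProd_pointSeq_succ (k i : ℕ) : (downProd (pointSeq m s) (k + 1)).coeff i =
    pointCoeff m s k (downProd swapSeq k i) * (downProd (pointSeq m s) k).coeff i := by
  rw [downProd_succ, Monomial.coeff_mul, perm_downProd_pointSeq]
  rfl

theorem coeff_downProd_pointSeq_of_gt {k i : ℕ} (hk : k < i) (hi : i ≤ m + 1) :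
    (downProd (pointSeq m s) k).coeff i = downProd s k := by
  induction k with
  | zero => simp
  | succ k ih =>
    rw [coeff_downProd_pointSeq_succ, downProd_swapSeq_apply, if_neg (by omega),
      if_neg (by omega), ih (by omega), pointCoeff_of_gt hk hi, downProd_succ]

theorem coeff_downProd_pointSeq {k i : ℕ} (hi₀ : 0 < i) (hi : i ≤ k + 1) (hk : k ≤ m) :
    (downProd (pointSeq m s) (k + 1)).coeff i = downProd s k := by
  induction k with
  | zero =>
    obtain rfl : i = 1 := by omega
    simp [downProd, pointSeq, pointCoeff]
  | succ k ih =>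
    rw [coeff_downProd_pointSeq_succ, downProd_swapSeq_apply, if_neg (by omega)]
    obtain rfl | h : i = k + 1 + 1 ∨ i ≤ k + 1 := by omega
    · rw [if_neg (by omega), pointCoeff_succ, coeff_downProd_pointSeq_of_gt (by omega) (by omega),
        one_mul]
    · rw [if_pos h, pointCoeff_of_lt (by omega), ih h (by omega), Nat.add_sub_cancel, downProd_succ]

theorem coeff_upProd_pointSeq_of_big {k i : ℕ} (hk : k ≤ m + 1) (hi : m + 1 < i) :
    (upProd (pointSeq m s) k).coeff i = 1 := by
  induction k with
  | zero => rfl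
  | succ k ih =>
    rw [coeff_upProd_pointSeq_succ, swapSeq_of_ne (by omega) (by omega), ih (by omega),
      pointCoeff_eq_one (by omega) (by omega), one_mul]

theorem coeff_downProd_pointSeq_of_big {k i : ℕ} (hk : k ≤ m + 1) (hi : m + 1 < i) :
    (downProd (pointSeq m s) k).coeff i = 1 := by
  induction k with
  | zero => rfl
  | succ k ih =>
    rw [coeff_downProd_pointSeq_succ, downProd_swapSeq_apply, if_neg (by omega),
      if_neg (by omega), ih (by omega), pointCoeff_eq_one (by omega) (by omega), one_mul]

theorem coeff_upProd_pointSeq_pow {t i : ℕ} (ht : t ≤ m + 2) (hi : i ≤ m + 1) :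
    (upProd (pointSeq m s) (m + 1) ^ t).coeff i =
      (downProd s m)⁻¹ ^ (if i + t ≤ m + 1 then t else t - 1) := by
  induction t generalizing i with
  | zero => simp
  | succ t ih =>
    rw [pow_succ, Monomial.coeff_mul, perm_upProd_pointSeq, Equiv.Perm.smul_def,
      upProd_swapSeq_apply]
    obtain rfl | h : i = m + 1 ∨ i ≤ m := by omega
    · rw [if_neg (by omega), if_pos rfl, ih (by omega) (by omega), coeff_upProd_pointSeq_self,
        mul_one, if_pos (by omega), if_neg (by omega), Nat.add_sub_cancel]
    · rw [if_pos (by omega), ih (by omega) (by omega), coeff_upProd_pointSeq h, ← pow_succ]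
      congr 1
      split_ifs <;> omega

theorem upProd_pointSeq_pow (hs : IsBraidSeq m s) (hz : upProd s m ^ (m + 1) = 1) :
    upProd (pointSeq m s) (m + 1) ^ (m + 2) = 1 := by
  have hp : (upProd (pointSeq m s) (m + 1) ^ (m + 2)).perm = 1 := by
    rw [← Monomial.permHom_apply, map_pow, Monomial.permHom_apply, perm_upProd_pointSeq,
      upProd_swapSeq_pow]
  refine Monomial.ext hp (funext fun i => ?_)
  by_cases hi : i ≤ m + 1
  · rw [coeff_upProd_pointSeq_pow le_rfl hi, if_neg (by omega), inv_pow,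
      show m + 2 - 1 = m + 1 by omega, hs.downProd_pow le_rfl, hz, inv_one, Monomial.coeff_one]
  · have hf : (upProd (pointSeq m s) (m + 1)).perm • i = i := by
      rw [perm_upProd_pointSeq, Equiv.Perm.smul_def, upProd_swapSeq_apply, if_neg (by omega),
        if_neg (by omega)]
    rw [Monomial.coeff_pow hf, coeff_upProd_pointSeq_of_big le_rfl (by omega), one_pow,
      Monomial.coeff_one]

theorem upProd_mul_downProd_pointSeq (hs : IsBraidSeq m s) (hz : upProd s m ^ (m + 1) = 1) :
    upProd (pointSeq m s) (m + 1) * downProd (pointSeq m s) (m + 1) = 1 := by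
  have hp : (upProd (pointSeq m s) (m + 1) * downProd (pointSeq m s) (m + 1)).perm = 1 := by
    rw [Monomial.perm_mul, perm_upProd_pointSeq, perm_downProd_pointSeq,
      upProd_mul_downProd_swapSeq]
  refine Monomial.ext hp (funext fun i => ?_)
  rw [Monomial.coeff_one]
  obtain rfl | ⟨h₀, h⟩ | h : i = 0 ∨ (0 < i ∧ i ≤ m + 1) ∨ m + 1 < i := by omega
  · have h := hs.isBraidSeq_pointSeq.fullTwist_succ (k := m) (by omega)
    rw [hs.upProd_pointSeq_pow hz] at h
    have hV : (upProd (pointSeq m s) m).perm • (m + 1) = m + 1 := by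
      rw [perm_upProd_pointSeq, Equiv.Perm.smul_def, upProd_swapSeq_apply, if_neg (by omega),
        if_neg (by omega)]
    have hV' : (upProd (pointSeq m s) m ^ (m + 1)).coeff (m + 1) = 1 := by
      rw [Monomial.coeff_pow hV, coeff_upProd_pointSeq_of_gt (by omega) le_rfl, hz]
    have hDU : (downProd (pointSeq m s) (m + 1) * upProd (pointSeq m s) (m + 1)).perm = 1 := by
      rw [Monomial.perm_mul, perm_upProd_pointSeq, perm_downProd_pointSeq]
      exact mul_eq_one_comm.1 (upProd_mul_downProd_swapSeq _)
    have h₁ := congrArg (fun g => g.coeff (m + 1)) h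
    simp only [Monomial.coeff_one, Monomial.coeff_mul _ (downProd _ _ * _), hDU, one_smul, hV',
      one_mul] at h₁
    have h₂ := congrArg (fun g => g.coeff (m + 1)) (mul_assoc (upProd (pointSeq m s) (m + 1))
      (downProd (pointSeq m s) (m + 1)) (upProd (pointSeq m s) (m + 1)))
    rw [Monomial.coeff_mul _ (upProd _ _), Monomial.coeff_mul _ (downProd _ _ * _), hDU, one_smul,
      ← h₁, coeff_upProd_pointSeq_self, mul_one, mul_one, perm_upProd_pointSeq,
      Equiv.Perm.smul_def, upProd_swapSeq_apply, if_neg (by omega), if_pos rfl] at h₂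
    exact h₂
  · rw [Monomial.coeff_mul, perm_downProd_pointSeq, Equiv.Perm.smul_def, downProd_swapSeq_apply,
      if_neg (by omega), if_pos h, coeff_upProd_pointSeq (by omega),
      coeff_downProd_pointSeq h₀ h le_rfl, inv_mul_cancel]
  · rw [Monomial.coeff_mul, perm_downProd_pointSeq, Equiv.Perm.smul_def, downProd_swapSeq_apply,
      if_neg (by omega), if_neg (by omega), coeff_upProd_pointSeq_of_big le_rfl h,
      coeff_downProd_pointSeq_of_big le_rfl h, one_mul]

end

end IsBraidSeq

/-! ### Mapping class groups of punctured spheres -/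

section Sphere

open IsBraidSeq

variable {m : ℕ}

/-- The generators of the mapping class group of the sphere with `m + 2` punctures. -/
def sphereSeq (m : ℕ) : ℕ → SphereMCG (m + 2) :=
  finSeq (m := m + 1) fun i => (PresentedGroup.of i : PresentedGroup (sphereRels (m + 2)))

theorem isBraidSeq_sphereSeq (m : ℕ) : IsBraidSeq (m + 1) (sphereSeq m) :=
  isBraidSeq_of_braidRels_subset (rels := sphereRels (m + 2)) Set.subset_union_left

theorem mk_prod_ofFn (m : ℕ) : PresentedGroup.mk (sphereRels (m + 2))
    (List.ofFn fun i : Fin (m + 1) => FreeGroup.of i).prod = upProd (sphereSeq m) (m + 1) := by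
  rw [map_list_prod, List.map_ofFn, ← prod_ofFn_eq_upProd]
  congr 2
  funext i
  exact (finSeq_val _ i).symm

theorem mk_prod_reverse_ofFn (m : ℕ) : PresentedGroup.mk (sphereRels (m + 2))
    (List.ofFn fun i : Fin (m + 1) => FreeGroup.of i).reverse.prod =
      downProd (sphereSeq m) (m + 1) := by
  rw [map_list_prod, List.map_reverse, List.map_ofFn, ← prod_reverse_ofFn_eq_downProd]
  congr 3
  funext i
  exact (finSeq_val _ i).symm

theorem upProd_mul_downProd_sphereSeq (m : ℕ) :
    upProd (sphereSeq m) (m + 1) * downProd (sphereSeq m) (m + 1) = 1 := by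
  rw [← mk_prod_ofFn, ← mk_prod_reverse_ofFn, ← map_mul]
  exact PresentedGroup.one_of_mem (.inr (.inl rfl))

theorem upProd_sphereSeq_pow (m : ℕ) : upProd (sphereSeq m) (m + 1) ^ (m + 2) = 1 := by
  rw [← mk_prod_ofFn, ← map_pow]
  exact PresentedGroup.one_of_mem (.inr (.inr rfl))

/-- The homomorphism from the mapping class group of a punctured sphere given by a sequence
satisfying the defining relations. -/
def sphereLift {G : Type*} [Group G] {s : ℕ → G} (hs : IsBraidSeq (m + 1) s)
    (h₁ : upProd s (m + 1) * downProd s (m + 1) = 1) (h₂ : upProd s (m + 1) ^ (m + 2) = 1) :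
    SphereMCG (m + 2) →* G :=
  PresentedGroup.toGroup (f := fun i : Fin (m + 1) => s i) <| by
    have h : FreeGroup.lift (fun i : Fin (m + 1) => s i)
        (List.ofFn fun i : Fin (m + 1) => FreeGroup.of i).prod = upProd s (m + 1) := by
      rw [map_list_prod, List.map_ofFn, ← prod_ofFn_eq_upProd]
      congr 2
      funext i
      exact FreeGroup.lift_apply_of
    have h' : FreeGroup.lift (fun i : Fin (m + 1) => s i)
        (List.ofFn fun i : Fin (m + 1) => FreeGroup.of i).reverse.prod = downProd s (m + 1) := by
      rw [map_list_prod, List.map_reverse, List.map_ofFn, ← prod_reverse_ofFn_eq_downProd]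
      congr 3
      funext i
      exact FreeGroup.lift_apply_of
    rintro r (hr | rfl | rfl)
    · exact hs.lift_eq_one hr
    · exact (map_mul _ _ _).trans ((congrArg₂ (· * ·) h h').trans h₁)
    · exact (map_pow _ _ _).trans ((congrArg (· ^ (m + 2)) h).trans h₂)

theorem sphereLift_sphereSeq {G : Type*} [Group G] {s : ℕ → G} (hs : IsBraidSeq (m + 1) s)
    (h₁ : upProd s (m + 1) * downProd s (m + 1) = 1) (h₂ : upProd s (m + 1) ^ (m + 2) = 1)
    {i : ℕ} (hi : i < m + 1) : sphereLift hs h₁ h₂ (sphereSeq m i) = s i := by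
  rw [sphereSeq, finSeq_of_lt _ hi]
  exact PresentedGroup.toGroup.of _

instance (m : ℕ) : (Subgroup.zpowers (braidTwist m)).Normal where
  conj_mem x hx g := by
    obtain ⟨k, rfl⟩ := hx
    exact ⟨k, by simp only [← ((commute_braidTwist g).zpow_left k).eq, mul_inv_cancel_right]⟩

/-- The braid group modulo the full twist. -/
abbrev BraidModTwist (m : ℕ) : Type :=
  PresentedGroup (braidRels m) ⧸ Subgroup.zpowers (braidTwist m)

/-- The generators of the braid group modulo the full twist. -/
def modTwistSeq (m : ℕ) (i : ℕ) : BraidModTwist m := QuotientGroup.mk' _ (braidSeq m i)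

theorem isBraidSeq_modTwistSeq (m : ℕ) : IsBraidSeq m (modTwistSeq m) :=
  (isBraidSeq_braidSeq m).map _

theorem upProd_modTwistSeq_pow (m : ℕ) : upProd (modTwistSeq m) m ^ (m + 1) = 1 := by
  have : upProd (modTwistSeq m) m = QuotientGroup.mk' _ (upProd (braidSeq m) m) :=
    (map_upProd (QuotientGroup.mk' _) _ _).symm
  rw [this, ← map_pow]
  exact (QuotientGroup.eq_one_iff _).2 (Subgroup.mem_zpowers _)

/-- The representation of the mapping class group by monomial matrices, induced from the
stabilizer of a puncture. -/
def sphereRep (m : ℕ) : SphereMCG (m + 2) →* Monomial ℕ (BraidModTwist m) :=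
  sphereLift (isBraidSeq_modTwistSeq m).isBraidSeq_pointSeq
    ((isBraidSeq_modTwistSeq m).upProd_mul_downProd_pointSeq (upProd_modTwistSeq_pow m))
    ((isBraidSeq_modTwistSeq m).upProd_pointSeq_pow (upProd_modTwistSeq_pow m))

theorem sphereRep_sphereSeq {i : ℕ} (hi : i < m + 1) :
    sphereRep m (sphereSeq m i) = pointSeq m (modTwistSeq m) i :=
  sphereLift_sphereSeq _ _ _ hi

/-- The action on the punctures. -/
def spherePerm (m : ℕ) : SphereMCG (m + 2) →* Equiv.Perm ℕ :=
  (Monomial.permHom _ _).comp (sphereRep m)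

theorem perm_sphereRep (g : SphereMCG (m + 2)) : (sphereRep m g).perm = spherePerm m g := rfl

theorem spherePerm_sphereSeq {i : ℕ} (hi : i < m + 1) :
    spherePerm m (sphereSeq m i) = swapSeq i := by
  rw [← perm_sphereRep, sphereRep_sphereSeq hi]
  rfl

theorem spherePerm_upProd {k : ℕ} (hk : k ≤ m + 1) :
    spherePerm m (upProd (sphereSeq m) k) = upProd swapSeq k := by
  rw [map_upProd]
  exact upProd_congr fun i hi => spherePerm_sphereSeq (by omega)

theorem upProd_sphereSeq_pow_eq_one (m : ℕ) : upProd (sphereSeq m) m ^ (m + 1) = 1 := by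
  have h := (isBraidSeq_sphereSeq m).fullTwist_succ (k := m) (by omega)
  rwa [upProd_sphereSeq_pow, mul_eq_one_comm.1 (upProd_mul_downProd_sphereSeq m), mul_one,
    eq_comm] at h

/-- The inclusion of the stabilizer of the last puncture. -/
def stabIncl (m : ℕ) : BraidModTwist m →* SphereMCG (m + 2) :=
  QuotientGroup.lift _ (braidLift ((isBraidSeq_sphereSeq m).mono (Nat.le_succ m))) <| by
    intro x hx
    have : braidTwist m ∈ (braidLift ((isBraidSeq_sphereSeq m).mono (Nat.le_succ m))).ker := by
      rw [MonoidHom.mem_ker, braidTwist, map_pow, braidLift_upProd _ le_rfl,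
        upProd_sphereSeq_pow_eq_one]
    exact (Subgroup.zpowers_le.2 this) hx

theorem stabIncl_modTwistSeq {i : ℕ} (hi : i < m) :
    stabIncl m (modTwistSeq m i) = sphereSeq m i :=
  braidLift_braidSeq ((isBraidSeq_sphereSeq m).mono (Nat.le_succ m)) hi

theorem spherePerm_stabIncl_mk (x : PresentedGroup (braidRels m)) :
    spherePerm m (stabIncl m (x : BraidModTwist m)) = braidLift (isBraidSeq_swapSeq m) x := by
  have : (spherePerm m).comp (braidLift ((isBraidSeq_sphereSeq m).mono (Nat.le_succ m))) =
      braidLift (isBraidSeq_swapSeq m) := by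
    ext i : 1
    rw [MonoidHom.comp_apply, braidLift_of, braidLift_of, spherePerm_sphereSeq (by omega)]
  exact DFunLike.congr_fun this x

theorem stabIncl_turn {j : ℕ} (hj : j ≤ m) :
    stabIncl m (turn m (modTwistSeq m) j) = turn m (sphereSeq m) j := by
  have h {k : ℕ} (hk : k ≤ m) : stabIncl m (upProd (modTwistSeq m) k) = upProd (sphereSeq m) k := by
    rw [map_upProd]
    exact upProd_congr fun i hi => stabIncl_modTwistSeq (by omega)
  have h' {k : ℕ} (hk : k ≤ m) :
      stabIncl m (downProd (modTwistSeq m) k) = downProd (sphereSeq m) k := by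
    induction k with
    | zero => rfl
    | succ k ih => rw [downProd_succ, map_mul, ih (by omega), stabIncl_modTwistSeq (by omega),
        downProd_succ]
  simp only [turn, map_mul, map_inv, h hj, h le_rfl, h' le_rfl]

/-- A mapping class taking the last puncture to the puncture `i`. -/
def transport (m i : ℕ) : SphereMCG (m + 2) :=
  (upProd (sphereSeq m) i)⁻¹ * upProd (sphereSeq m) (m + 1)

theorem spherePerm_transport {i : ℕ} (hi : i ≤ m + 1) :
    spherePerm m (transport m i) (m + 1) = i := by
  rw [transport, map_mul, map_inv, spherePerm_upProd hi, spherePerm_upProd le_rfl,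
    Equiv.Perm.mul_apply, Equiv.Perm.inv_eq_iff_eq, upProd_swapSeq_apply, upProd_swapSeq_apply]
  simp

theorem sphereSeq_mul_transport_self {j : ℕ} (hj : j ≤ m) :
    sphereSeq m j * transport m j = transport m (j + 1) * (turn m (sphereSeq m) j)⁻¹ := by
  set T := sphereSeq m
  have hT : IsBraidSeq (m + 1) T := isBraidSeq_sphereSeq m
  set U := upProd T (m + 1)
  suffices h : ∀ k j, j + k = m →
      U⁻¹ * (upProd T j * T j ^ 2 * (upProd T j)⁻¹) * U = (turn m T j)⁻¹ by
    rw [transport, transport, ← h (m - j) j (by omega)]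
    change T j * ((upProd T j)⁻¹ * U) = (upProd T j * T j)⁻¹ * U * _
    simp only [mul_inv_rev, mul_assoc, mul_inv_cancel_left, inv_mul_cancel_left, sq]
  intro k
  induction k with
  | zero =>
    intro j hj
    obtain rfl : j = m := hj
    have h := mul_eq_one_comm.1 (upProd_mul_downProd_sphereSeq j)
    change downProd T (j + 1) * upProd T (j + 1) = 1 at h
    rw [downProd_succ, upProd_succ] at h
    have hU : U = upProd T j * T j := rfl
    rw [turn_self, eq_inv_iff_mul_eq_one, hU]
    have h' := mul_eq_one_comm.1 (show T j * (downProd T j * upProd T j) * T j = 1 by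
      simpa only [mul_assoc] using h)
    simpa [sq, mul_assoc] using h'
  | succ k ih =>
    intro j hj
    have h₁ := ih (j + 1) (by omega)
    have h₂ : (turn m T j)⁻¹ = T j * (turn m T (j + 1))⁻¹ * (T j)⁻¹ := by
      rw [eq_mul_inv_of_mul_eq (turn_mul (m := m) T j)]
      group
    have hU : U * T j = T (j + 1) * U := hT.upProd_mul (by omega) le_rfl
    have hc : Commute (T (j + 1)) (upProd T j) :=
      commute_upProd fun i hi => hT.commute (by omega) (by omega) (by omega)
    have hb := hT.braid j (by omega)
    have hU' : T j * U⁻¹ = U⁻¹ * T (j + 1) := by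
      rw [eq_inv_mul_iff_mul_eq, ← mul_assoc, hU, mul_inv_cancel_right]
    have h₃ : T (j + 1) * T j * T (j + 1) ^ 2 * (T j)⁻¹ = T j ^ 2 * T (j + 1) := by
      rw [mul_inv_eq_iff_eq_mul, sq, sq, ← mul_assoc, ← hb, mul_assoc (T j * T j), mul_assoc (T j),
        mul_assoc (T j), ← hb]
      simp only [mul_assoc]
    have h₄ : upProd T j * T j ^ 2 * (upProd T j)⁻¹ * T (j + 1) =
        T (j + 1) * (upProd T (j + 1) * T (j + 1) ^ 2 * (upProd T (j + 1))⁻¹) := by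
      rw [mul_assoc _ _ (T (j + 1)), ← hc.inv_right.eq, ← mul_assoc, mul_assoc (upProd T j), ← h₃,
        upProd_succ, mul_inv_rev]
      simp only [← mul_assoc, hc.eq]
    rw [h₂, ← h₁, eq_mul_inv_iff_mul_eq, mul_assoc _ U, hU, ← mul_assoc, mul_assoc U⁻¹, h₄,
      ← mul_assoc, ← hU']
    simp only [mul_assoc]

theorem sphereSeq_mul_transport {i j : ℕ} (hi : i ≤ m + 1) (hj : j ≤ m) :
    sphereSeq m j * transport m i =
      transport m (swapSeq j i) * stabIncl m (pointCoeff m (modTwistSeq m) j i) := by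
  have hT := isBraidSeq_sphereSeq m
  obtain h | rfl | rfl | h : i < j ∨ i = j ∨ i = j + 1 ∨ j + 1 < i := by omega
  · obtain ⟨j, rfl⟩ : ∃ l, j = l + 1 := ⟨j - 1, by omega⟩
    have hc : Commute (sphereSeq m (j + 1)) (upProd (sphereSeq m) i) :=
      commute_upProd fun l hl => hT.commute (by omega) (by omega) (by omega)
    rw [swapSeq_of_ne (by omega) (by omega), pointCoeff_of_lt h, Nat.add_sub_cancel,
      stabIncl_modTwistSeq (by omega), transport, mul_assoc, hT.upProd_mul (by omega) le_rfl,
      ← mul_assoc, hc.inv_right.eq, mul_assoc]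
  · rw [swapSeq_self, pointCoeff_self, map_inv, stabIncl_turn hj, sphereSeq_mul_transport_self hj]
  · rw [swapSeq_succ, pointCoeff_succ, map_one, mul_one, transport, transport, upProd_succ,
      mul_inv_rev, mul_assoc, mul_inv_cancel_left]
  · have h₂ : (upProd (sphereSeq m) i)⁻¹ * sphereSeq m (j + 1) =
        sphereSeq m j * (upProd (sphereSeq m) i)⁻¹ := by
      rw [inv_mul_eq_iff_eq_mul, ← mul_assoc, hT.upProd_mul h hi, mul_inv_cancel_right]
    rw [swapSeq_of_ne (by omega) (by omega), pointCoeff_of_gt h hi,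
      stabIncl_modTwistSeq (by omega), transport, mul_assoc, hT.upProd_mul (by omega) le_rfl,
      ← mul_assoc, ← h₂, mul_assoc]

theorem mul_transport (g : SphereMCG (m + 2)) (i : ℕ) :
    (spherePerm m g i ≤ m + 1 ↔ i ≤ m + 1) ∧ (i ≤ m + 1 → g * transport m i =
      transport m (spherePerm m g i) * stabIncl m ((sphereRep m g).coeff i)) := by
  let p : Subgroup (SphereMCG (m + 2)) :=
    { carrier := {g | ∀ i, (spherePerm m g i ≤ m + 1 ↔ i ≤ m + 1) ∧ (i ≤ m + 1 →
        g * transport m i =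
          transport m (spherePerm m g i) * stabIncl m ((sphereRep m g).coeff i))}
      one_mem' := fun i => by simp
      mul_mem' := fun {g h} hg hh i => by
        refine ⟨?_, fun hi => ?_⟩
        · rw [map_mul, Equiv.Perm.mul_apply, (hg _).1, (hh i).1]
        · rw [mul_assoc, (hh i).2 hi, ← mul_assoc, (hg _).2 ((hh i).1.2 hi), map_mul, map_mul,
            Monomial.coeff_mul, map_mul, mul_assoc]
          rfl
      inv_mem' := fun {g} hg i => by
        have h := hg ((spherePerm m g)⁻¹ i)
        rw [show spherePerm m g ((spherePerm m g)⁻¹ i) = i from Equiv.apply_symm_apply _ _] at h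
        refine ⟨by rw [map_inv, h.1], fun hi => ?_⟩
        have h₁ : (sphereRep m g⁻¹).coeff i =
            ((sphereRep m g).coeff ((spherePerm m g)⁻¹ i))⁻¹ := by
          rw [map_inv]
          rfl
        rw [map_inv, h₁, map_inv, inv_mul_eq_iff_eq_mul, ← mul_assoc, h.2 (h.1.1 hi),
          mul_inv_cancel_right] }
  refine PresentedGroup.induction_of (p := p) (fun a i => ?_) g i
  have ha : PresentedGroup.of a = sphereSeq m a := (finSeq_val _ a).symm
  have ha' : (a : ℕ) < m + 1 := a.2
  rw [ha, spherePerm_sphereSeq ha', sphereRep_sphereSeq ha']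
  refine ⟨?_, fun hi => sphereSeq_mul_transport hi (by omega)⟩
  rw [swapSeq_apply]
  split_ifs <;> omega

theorem eq_transport_mul (g : SphereMCG (m + 2)) {i : ℕ} (hi : i ≤ m + 1)
    (h : spherePerm m g i = i) :
    g = transport m i * stabIncl m ((sphereRep m g).coeff i) * (transport m i)⁻¹ := by
  rw [eq_mul_inv_iff_mul_eq, (mul_transport g i).2 hi, h]

theorem coeff_sphereRep_pow {g : SphereMCG (m + 2)} {i : ℕ} (h : spherePerm m g i = i) {k : ℕ}
    (hk : g ^ k = 1) : (sphereRep m g).coeff i ^ k = 1 := by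
  rw [← Monomial.coeff_pow h, ← map_pow, hk, map_one, Monomial.coeff_one]

/-- A mapping class of finite order fixing three punctures is trivial. -/
theorem eq_one_of_fixes_three {g : SphereMCG (m + 2)} {k a b c : ℕ} (hk : 0 < k) (hg : g ^ k = 1)
    (hab : a ≠ b) (hac : a ≠ c) (hbc : b ≠ c) (ha : a ≤ m + 1) (hb : b ≤ m + 1) (hc : c ≤ m + 1)
    (hga : spherePerm m g a = a) (hgb : spherePerm m g b = b) (hgc : spherePerm m g c = c) :
    g = 1 := by
  have hx := coeff_sphereRep_pow hga hg
  have hg' := eq_transport_mul g ha hga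
  set t := transport m a
  obtain ⟨x, hx'⟩ := QuotientGroup.mk_surjective ((sphereRep m g).coeff a)
  rw [← hx'] at hx hg'
  have ht : spherePerm m t (m + 1) = a := spherePerm_transport ha
  have hconj : stabIncl m (x : BraidModTwist m) = t⁻¹ * g * t := by
    rw [hg']
    group
  have key {d : ℕ} (had : a ≠ d) (hd : d ≤ m + 1) (hgd : spherePerm m g d = d) :
      (spherePerm m t)⁻¹ d ≤ m ∧
        braidLift (isBraidSeq_swapSeq m) x ((spherePerm m t)⁻¹ d) = (spherePerm m t)⁻¹ d := by
    have h₁ : spherePerm m t ((spherePerm m t)⁻¹ d) = d := Equiv.apply_symm_apply _ _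
    constructor
    · have h₂ : (spherePerm m t)⁻¹ d ≠ m + 1 := fun h => had (by rw [← h₁, h, ht])
      have h₃ := (mul_transport t ((spherePerm m t)⁻¹ d)).1
      rw [h₁] at h₃
      have := h₃.1 hd
      omega
    · rw [← spherePerm_stabIncl_mk, hconj, map_mul, map_mul, Equiv.Perm.mul_apply,
        Equiv.Perm.mul_apply, h₁, hgd, map_inv]
  obtain ⟨hb₁, hb₂⟩ := key hab hb hgb
  obtain ⟨hc₁, hc₂⟩ := key hac hc hgc
  have := mem_zpowers_braidTwist hk ((QuotientGroup.eq_one_iff _).1 hx)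
    ((spherePerm m t)⁻¹.injective.ne hbc) hb₁ hc₁ hb₂ hc₂
  rw [hg', (QuotientGroup.eq_one_iff x).2 this, map_one, mul_one, mul_inv_cancel]

/-- A mapping class of finite order fixing a puncture, and inverted by a mapping class fixing
the same puncture, is an involution. -/
theorem sq_eq_one_of_inverted {g h : SphereMCG (m + 2)} {k a : ℕ} (hm : 0 < m) (hk : 0 < k)
    (hg : g ^ k = 1) (hgh : h * g * h⁻¹ = g⁻¹) (ha : a ≤ m + 1) (hga : spherePerm m g a = a)
    (hha : spherePerm m h a = a) : g ^ 2 = 1 := by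
  have hx := coeff_sphereRep_pow hga hg
  have hg' := eq_transport_mul g ha hga
  have hxy : (sphereRep m h).coeff a * (sphereRep m g).coeff a * ((sphereRep m h).coeff a)⁻¹ *
      (sphereRep m g).coeff a = 1 := by
    let S := (MulAction.stabilizer (Equiv.Perm ℕ) a).comap
      (Monomial.permHom ℕ (BraidModTwist m))
    let g₁ : S := ⟨sphereRep m g, hga⟩
    let h₁ : S := ⟨sphereRep m h, hha⟩
    have h₂ : h₁ * g₁ * h₁⁻¹ * g₁ = 1 := by
      apply Subtype.ext
      change sphereRep m h * sphereRep m g * (sphereRep m h)⁻¹ * sphereRep m g = 1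
      rw [← map_inv, ← map_mul, ← map_mul, ← map_mul, hgh, inv_mul_cancel, map_one]
    have h₃ := congrArg (Monomial.coeffHom a) h₂
    rw [map_mul, map_mul, map_mul, map_inv, map_one] at h₃
    exact h₃
  obtain ⟨x, hx'⟩ := QuotientGroup.mk_surjective ((sphereRep m g).coeff a)
  obtain ⟨y, hy'⟩ := QuotientGroup.mk_surjective ((sphereRep m h).coeff a)
  rw [← hx'] at hx hg' hxy
  rw [← hy'] at hxy
  have := sq_mem_zpowers_braidTwist hm hk ((QuotientGroup.eq_one_iff _).1 hx)
    ((QuotientGroup.eq_one_iff _).1 hxy)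
  rw [hg', conj_pow, ← map_pow, ← QuotientGroup.mk_pow, (QuotientGroup.eq_one_iff _).2 this,
    map_one, mul_one, mul_inv_cancel]

/-- A mapping class of order `m + 1` of the sphere with `m + 2` punctures is not conjugate to
its inverse. -/
theorem not_inverted_of_orderOf {g h : SphereMCG (m + 2)} (hm : 4 ≤ m) (hg : orderOf g = m + 1)
    (hgh : h * g * h⁻¹ = g⁻¹) : False := by
  set p := spherePerm m g with hp
  have hgn : g ^ (m + 1) = 1 := hg ▸ pow_orderOf_eq_one g
  have hpn : p ^ (m + 1) = 1 := by rw [hp, ← map_pow, hgn, map_one]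
  have hne {l : ℕ} (h₀ : 0 < l) (hl : l < m + 1) : g ^ l ≠ 1 :=
    pow_ne_one_of_lt_orderOf h₀.ne' (hg ▸ hl)
  have hle (l i : ℕ) : (p ^ l) i ≤ m + 1 ↔ i ≤ m + 1 := by
    rw [hp, ← map_pow]
    exact (mul_transport (g ^ l) i).1
  have hfix {l a b c : ℕ} (h₀ : 0 < l) (hl : l < m + 1) (hab : a ≠ b) (hac : a ≠ c) (hbc : b ≠ c)
      (ha : a ≤ m + 1) (hb : b ≤ m + 1) (hc : c ≤ m + 1) (hga : (p ^ l) a = a)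
      (hgb : (p ^ l) b = b) (hgc : (p ^ l) c = c) : False := by
    refine hne h₀ hl (eq_one_of_fixes_three (k := m + 1) (by omega) ?_ hab hac hbc ha hb hc ?_ ?_ ?_)
    · rw [← pow_mul, mul_comm, pow_mul, hgn, one_pow]
    all_goals rwa [map_pow]
  obtain ⟨x, hx, hx₂⟩ : ∃ x ≤ m + 1, (p ^ 2) x ≠ x := by
    by_contra! hc
    exact hfix (l := 2) (a := 0) (b := 1) (c := 2) (by omega) (by omega) (by omega) (by omega)
      (by omega) (by omega) (by omega) (by omega) (hc _ (by omega)) (hc _ (by omega))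
      (hc _ (by omega))
  have hfree {l : ℕ} (h₀ : 0 < l) (hl : l < m + 1) : (p ^ l) x ≠ x := by
    intro hlx
    have hcomm (j : ℕ) : (p ^ l) ((p ^ j) x) = (p ^ j) x := by
      rw [← Equiv.Perm.mul_apply, ← pow_add, add_comm, pow_add, Equiv.Perm.mul_apply, hlx]
    have h₁ : (p ^ 1) x ≠ x := by
      intro h
      rw [pow_one] at h
      exact hx₂ (by rw [sq, Equiv.Perm.mul_apply, h, h])
    refine hfix (a := x) (b := (p ^ 1) x) (c := (p ^ 2) x) h₀ hl h₁.symm hx₂.symm ?_ hx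
      ((hle _ _).2 hx) ((hle _ _).2 hx) hlx (hcomm 1) (hcomm 2)
    intro h
    rw [pow_one, sq, Equiv.Perm.mul_apply, p.injective.eq_iff] at h
    exact h₁ h.symm
  set O := (Finset.range (m + 1)).image fun t => (p ^ t) x with hO
  have hOcard : O.card = m + 1 := by
    rw [hO, Finset.card_image_of_injOn, Finset.card_range]
    have hlt {a b : ℕ} (hab : a < b) (hb : b < m + 1) : (p ^ a) x ≠ (p ^ b) x := by
      intro h
      rw [← Nat.add_sub_cancel' hab.le, pow_add, Equiv.Perm.mul_apply, (p ^ a).injective.eq_iff] at h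
      exact hfree (Nat.sub_pos_of_lt hab) (by omega) h.symm
    intro a ha b hb h
    simp only [Finset.coe_range, Set.mem_Iio] at ha hb
    rcases lt_trichotomy a b with hab | hab | hab
    · exact (hlt hab hb h).elim
    · exact hab
    · exact (hlt hab ha h.symm).elim
  have hOsub : O ⊆ Finset.range (m + 2) := by
    intro y hy
    obtain ⟨t, -, rfl⟩ := Finset.mem_image.1 hy
    have := (hle t x).2 hx
    simp only [Finset.mem_range]
    omega
  obtain ⟨P, hP⟩ := Finset.card_eq_one.1 (show (Finset.range (m + 2) \ O).card = 1 by
    rw [Finset.card_sdiff_of_subset hOsub, hOcard, Finset.card_range]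
    omega)
  have hPO : P ∉ O := by
    have : P ∈ Finset.range (m + 2) \ O := by simp [hP]
    exact (Finset.mem_sdiff.1 this).2
  have hPm : P ≤ m + 1 := by
    have : P ∈ Finset.range (m + 2) \ O := by simp [hP]
    have := Finset.mem_range.1 (Finset.mem_sdiff.1 this).1
    omega
  have hmem (t : ℕ) : (p ^ t) x ∈ O := by
    rw [← pow_mod_orderOf]
    have ho : orderOf p ≤ m + 1 := Nat.le_of_dvd (by omega) (orderOf_dvd_of_pow_eq_one hpn)
    have ho' : 0 < orderOf p := Nat.pos_of_dvd_of_pos (orderOf_dvd_of_pow_eq_one hpn) (by omega)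
    exact Finset.mem_image.2 ⟨_, Finset.mem_range.2 ((Nat.mod_lt _ ho').trans_le ho), rfl⟩
  have huniq {y : ℕ} (hy : y ≤ m + 1) (hyO : y ∉ O) : y = P := by
    rw [← Finset.mem_singleton, ← hP, Finset.mem_sdiff, Finset.mem_range]
    exact ⟨by omega, hyO⟩
  have hpP : p P = P := by
    refine huniq ?_ fun h => hPO ?_
    · simpa using (hle 1 P).2 hPm
    · obtain ⟨t, -, ht⟩ := Finset.mem_image.1 h
      have h₁ : P = (p ^ (t + m)) x := by
        apply p.injective
        rw [← ht, ← Equiv.Perm.mul_apply, ← pow_succ', add_assoc, pow_add, hpn, mul_one]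
      rw [h₁]
      exact hmem _
  have hhP : spherePerm m h P = P := by
    refine huniq ((mul_transport h P).1.2 hPm) fun hy => ?_
    obtain ⟨t, -, ht⟩ := Finset.mem_image.1 hy
    have h₁ : g * h = h * g⁻¹ := by
      have h₂ := congrArg (·⁻¹) hgh
      simp only [mul_inv_rev, inv_inv] at h₂
      rw [eq_comm, ← mul_inv_eq_iff_eq_mul, mul_assoc, h₂]
    have h₂ : p (spherePerm m h P) = spherePerm m h P := by
      have := congrArg (fun f => spherePerm m f P) h₁
      simp only [map_mul, map_inv, Equiv.Perm.mul_apply] at this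
      rwa [show (spherePerm m g)⁻¹ P = P from Equiv.Perm.inv_eq_iff_eq.2 hpP.symm] at this
    rw [← ht, ← Equiv.Perm.mul_apply, ← pow_succ', pow_succ, Equiv.Perm.mul_apply,
      (p ^ t).injective.eq_iff] at h₂
    exact hfree (l := 1) (by omega) (by omega) (by simpa using h₂)
  exact hne (by omega) (by omega) (sq_eq_one_of_inverted (by omega) (by omega) hgn hgh hPm hpP hhP)

end Sphere

/-! ### The half twist -/

namespace IsBraidSeq

variable {G : Type*} [Group G] {m : ℕ} {s : ℕ → G}

/-- The positive half twist. -/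
def halfTwist (s : ℕ → G) : ℕ → G
  | 0 => 1
  | k + 1 => upProd s (k + 1) * halfTwist s k

theorem commute_halfTwist (hs : IsBraidSeq m s) {i k : ℕ} (hk : k < i) (hi : i < m) :
    Commute (s i) (halfTwist s k) := by
  induction k with
  | zero => exact Commute.one_right _
  | succ k ih =>
    exact (commute_upProd fun j hj => hs.commute hi (by omega) (by omega)).mul_right
      (ih (by omega))

theorem halfTwist_mul (hs : IsBraidSeq m s) {i k : ℕ} (hi : i < k) (hk : k ≤ m) :
    halfTwist s k * s i = s (k - 1 - i) * halfTwist s k := by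
  induction k generalizing i with
  | zero => omega
  | succ k ih =>
    rw [halfTwist]
    obtain hik | rfl : i < k ∨ i = k := by omega
    · rw [mul_assoc, ih hik (by omega), ← mul_assoc, hs.upProd_mul (by omega) hk, mul_assoc,
        show k - 1 - i + 1 = k + 1 - 1 - i by omega]
    · obtain _ | i := i
      · simp [halfTwist, upProd]
      have h := hs.upProd_sq_mul (k := i + 1) hk
      have h' : upProd s (i + 1 + 1) * upProd s (i + 1) * s (i + 1) =
          s 0 * (upProd s (i + 1 + 1) * upProd s (i + 1)) := by
        apply mul_right_cancel (b := s (i + 1))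
        simpa only [sq, upProd_succ s (i + 1), mul_assoc] using h
      rw [halfTwist, mul_assoc, mul_assoc, (hs.commute_halfTwist i.lt_succ_self hk).symm.eq,
        ← mul_assoc, ← mul_assoc, h', Nat.add_sub_cancel, Nat.sub_self]
      simp only [mul_assoc]

theorem halfTwist_mul_upProd (hs : IsBraidSeq m s) {k j : ℕ} (hk : k < m) (hj : j ≤ k + 1) :
    halfTwist s (k + 1) * upProd s j = descProd s k j * halfTwist s (k + 1) := by
  induction j with
  | zero => simp [descProd]
  | succ j ih =>
    rw [upProd_succ, ← mul_assoc, ih (by omega), mul_assoc, hs.halfTwist_mul (by omega) hk,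
      descProd, mul_assoc, show k.succ - 1 - j = k - j from rfl]

theorem halfTwist_mul_upProd_self (hs : IsBraidSeq m s) {k : ℕ} (hk : k < m) :
    halfTwist s (k + 1) * upProd s (k + 1) = downProd s (k + 1) * halfTwist s (k + 1) := by
  rw [hs.halfTwist_mul_upProd hk le_rfl, descProd_eq_downProd]

end IsBraidSeq

theorem orderOf_upProd_sphereSeq (m : ℕ) : orderOf (upProd (sphereSeq m) (m + 1)) = m + 2 := by
  rw [orderOf_eq_iff (by omega)]
  refine ⟨upProd_sphereSeq_pow m, fun t ht h₀ h => ?_⟩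
  have := congrArg (fun f => spherePerm m f 0) h
  simp only [map_pow, spherePerm_upProd le_rfl, map_one, Equiv.Perm.one_apply] at this
  rw [upProd_swapSeq_pow_apply (by omega) (by omega), if_pos (by omega)] at this
  omega

/-- For `n ≥ 5`, there is no injective homomorphism from the mapping class
group of the `n`-punctured sphere to that of the `(n+1)`-punctured sphere. -/
theorem sphereMCG_no_injection_succ (n : ℕ) (hn : 5 ≤ n)
    (ρ : SphereMCG n →* SphereMCG (n + 1)) :
    ¬ Function.Injective ρ := by
  intro hρ
  obtain ⟨k, rfl⟩ : ∃ k, n = k + 2 := ⟨n - 2, by omega⟩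
  set U := upProd (sphereSeq k) (k + 1) with hU
  set Δ := IsBraidSeq.halfTwist (sphereSeq k) (k + 1) with hΔ
  have h : Δ * U * Δ⁻¹ = U⁻¹ := by
    rw [hU, hΔ, (isBraidSeq_sphereSeq k).halfTwist_mul_upProd_self (by omega),
      mul_inv_cancel_right]
    exact (inv_eq_of_mul_eq_one_right (upProd_mul_downProd_sphereSeq k)).symm
  have ho : orderOf (ρ U) = k + 1 + 1 := by
    rw [orderOf_injective ρ hρ, hU, orderOf_upProd_sphereSeq]
  exact not_inverted_of_orderOf (m := k + 1) (h := ρ Δ) (by omega) ho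
    (by rw [← map_mul, ← map_inv, ← map_mul, h, map_inv])
end
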